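/- Let C_r be the cycle graph with r vertices where r ≥ 3 is odd, and let J(C_r) be its cover ideal in R = K[x_1,…,x_r]. Then sdst(J(C_r)) = 1 if r = 5, and sdst(J(C_r)) = (r−1)/2 otherwise. -/

import Mathlib

open SimpleGraph

namespace DS

variable {V : Type*}

/-- The set of edges of a matching presented by the endpoint functions `u`, `v`. -/
def omEdges {s : ℕ} (u v : Fin s → V) : Set (Sym2 V) := {e | ∃ i, e = s(u i, v i)}

/-- `(u, v)` describes a matching of size `s` in `G`: the `2s` endpoints are pairwise
distinct (so the edges are pairwise disjoint) and each pair `{u i, v i}` is an edge. -/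
def IsMatchingPair (G : SimpleGraph V) {s : ℕ} (u v : Fin s → V) : Prop :=
  Function.Injective (Sum.elim u v) ∧ ∀ i, G.Adj (u i) (v i)

/-- `(u, v)` describes an ordered matching: a matching such that `{u 1, …, u s}` is an
independent set and `{u i, v j} ∈ E(G)` implies `i ≤ j`. -/
def IsOrderedMatching (G : SimpleGraph V) {s : ℕ} (u v : Fin s → V) : Prop :=
  IsMatchingPair G u v ∧ (∀ i j, ¬ G.Adj (u i) (u j)) ∧
    ∀ i j, G.Adj (u i) (v j) → i ≤ j

/-- The matching number of `G`. -/
noncomputable def nu (G : SimpleGraph V) : ℕ :=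
  sSup {s | ∃ u v : Fin s → V, IsMatchingPair G u v}

/-- The ordered matching number of `G`. -/
noncomputable def nu0 (G : SimpleGraph V) : ℕ :=
  sSup {s | ∃ u v : Fin s → V, IsOrderedMatching G u v}

/-- A walk is `M`-alternating if its edges are alternately in `M` and not in `M`. -/
def IsAlt {G : SimpleGraph V} (M : Set (Sym2 V)) {a b : V} (w : G.Walk a b) : Prop :=
  List.Chain' (fun e f => (e ∈ M ↔ f ∉ M)) w.edges

/-- The walk `w` is nonempty and its first and last edges belong to `M`. -/
def FirstLastInM {G : SimpleGraph V} (M : Set (Sym2 V)) {a b : V} (w : G.Walk a b) : Prop :=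
  ∃ h : w.edges ≠ [], w.edges.head h ∈ M ∧ w.edges.getLast h ∈ M

/-- `w` is an `M`-admissible path for the vertex `x` (with respect to the ordered matching
presented by `(u, v)`): an `M`-alternating path with origin `x` whose first and last
edges are in `M`, each of whose edges has an end in `A = range u` and an end in
`B = range v`. -/
def IsAdmissible {G : SimpleGraph V} {s : ℕ} (u v : Fin s → V) {a b : V}
    (w : G.Walk a b) (x : V) : Prop :=
  a = x ∧ IsAlt (omEdges u v) w ∧ FirstLastInM (omEdges u v) w ∧
    ∀ e ∈ w.edges, ∃ i j, e = s(u i, v j)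

/-- `ℓ(x)`: the length of a longest `M`-admissible path for `x`. -/
noncomputable def ellv (G : SimpleGraph V) {s : ℕ} (u v : Fin s → V) (x : V) : ℕ :=
  sSup {n | ∃ (b : V) (w : G.Walk x b), IsAdmissible u v w x ∧ w.length = n}

/-- `ℓ(M)`: the length of a longest `M`-alternating path in `G`. -/
noncomputable def ellM (G : SimpleGraph V) (M : Set (Sym2 V)) : ℕ :=
  sSup {n | ∃ (a b : V) (w : G.Walk a b), IsAlt M w ∧ w.length = n}

/-- `ℓ₀(M) = max {ℓ(x) : x ∈ B}`. -/
noncomputable def ell0 (G : SimpleGraph V) {s : ℕ} (u v : Fin s → V) : ℕ :=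
  sSup {n | ∃ i : Fin s, ellv G u v (v i) = n}

/-- `ℓ₁(M) = max {ℓ(x) + ℓ(y) + 1 : {x, y} ∈ E(G[B])}` (with the convention that this
is `0` when `B` is independent, since `sSup ∅ = 0`). -/
noncomputable def ell1 (G : SimpleGraph V) {s : ℕ} (u v : Fin s → V) : ℕ :=
  sSup {n | ∃ i j : Fin s, G.Adj (v i) (v j) ∧ ellv G u v (v i) + ellv G u v (v j) + 1 = n}

/-- `ℓ(G) = min {ℓ(M) : M a maximum ordered matching of G}`. -/
noncomputable def ellG (G : SimpleGraph V) : ℕ :=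
  sInf {n | ∃ u v : Fin (nu0 G) → V, IsOrderedMatching G u v ∧ ellM G (omEdges u v) = n}

open MvPolynomial in
/-- The `n`-th symbolic power `J(G)^{(n)} = ⋂_{{u,v} ∈ E(G)} (x_u, x_v)^n` of the cover
ideal of `G`. -/
noncomputable def symbPow (K : Type*) [Field K] (G : SimpleGraph V) (n : ℕ) :
    Ideal (MvPolynomial V K) :=
  ⨅ (p : V × V) (_ : G.Adj p.1 p.2), (Ideal.span {X p.1, X p.2}) ^ n

/-- The cover ideal `J(G) = ⋂_{{u,v} ∈ E(G)} (x_u, x_v)`. -/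
noncomputable def coverIdeal (K : Type*) [Field K] (G : SimpleGraph V) :
    Ideal (MvPolynomial V K) :=
  symbPow K G 1

/-- `depth R/I`: the length of a maximal `R/I`-regular sequence contained in the maximal
homogeneous ideal `(x_1, …, x_r)` of `R = K[x_1, …, x_r]`. -/
noncomputable def depthQ (K : Type*) [Field K] (I : Ideal (MvPolynomial V K)) : ℕ :=
  sSup {n | ∃ rs : List (MvPolynomial V K), rs.length = n ∧
    (∀ f ∈ rs, f ∈ Ideal.span (Set.range (MvPolynomial.X : V → MvPolynomial V K))) ∧
    RingTheory.Sequence.IsRegular (MvPolynomial V K ⧸ I) rs}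

/-- The stability index of the symbolic depth function of `J(G)`:
`sdst(J(G)) = min {n₀ ≥ 1 : depth R/J(G)^{(n)} = r − ν₀(G) − 1 for all n ≥ n₀}`. -/
noncomputable def sdst (K : Type*) [Field K] [Fintype V] (G : SimpleGraph V) : ℕ :=
  sInf {n0 | 1 ≤ n0 ∧ ∀ n, n0 ≤ n →
    depthQ K (symbPow K G n) = Fintype.card V - nu0 G - 1}

/-- The stability index of the depth function of `J(G)`:
the least `n₀ ≥ 1` such that `depth R/J(G)^n` is constant for `n ≥ n₀` (hence equal to
its limit value). -/
noncomputable def dst (K : Type*) [Field K] [Fintype V] (G : SimpleGraph V) : ℕ :=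
  sInf {n0 | 1 ≤ n0 ∧ ∀ m n, n0 ≤ m → n0 ≤ n →
    depthQ K (coverIdeal K G ^ m) = depthQ K (coverIdeal K G ^ n)}

end DS

namespace DS

open MvPolynomial

universe u

section Ext

open CategoryTheory Abelian

/-- `Ext^i_R(N, M) = 0` for all `i < d`. -/
def ExtVanish {R : Type u} [CommRing R] (N : Type u) [AddCommGroup N] [Module R N] (d : ℕ)
    (M : Type u) [AddCommGroup M] [Module R M] : Prop :=
  ∀ i < d, ∀ x : Ext (ModuleCat.of R N) (ModuleCat.of R M) i, x = 0

namespace ExtVanish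

variable {R : Type u} [CommRing R] {N : Type u} [AddCommGroup N] [Module R N] {d : ℕ}
variable {A B C : Type u} [AddCommGroup A] [Module R A] [AddCommGroup B] [Module R B]
  [AddCommGroup C] [Module R C]

lemma mono {e : ℕ} (h : ExtVanish (R := R) N d A) (hed : e ≤ d) : ExtVanish (R := R) N e A :=
  fun i hi => h i (hi.trans_le hed)

lemma shortExact {f : A →ₗ[R] B} {g : B →ₗ[R] C} (hf : Function.Injective f)
    (hg : Function.Surjective g) (hfg : Function.Exact f g) :
    (ModuleCat.shortComplexOfCompEqZero f g hfg.linearMap_comp_eq_zero).ShortExact where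
  exact := ModuleCat.shortComplex_exact _ hfg
  mono_f := by simpa [ModuleCat.mono_iff_injective] using hf
  epi_g := by simpa [ModuleCat.epi_iff_surjective] using hg

lemma middle {f : A →ₗ[R] B} {g : B →ₗ[R] C} (hf : Function.Injective f)
    (hg : Function.Surjective g) (hfg : Function.Exact f g)
    (hA : ExtVanish (R := R) N d A) (hC : ExtVanish (R := R) N d C) :
    ExtVanish (R := R) N d B := by
  intro i hi x
  obtain ⟨y, rfl⟩ := Ext.covariant_sequence_exact₂ (ModuleCat.of R N) (shortExact hf hg hfg) x
    (hC i hi _)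
  rw [hA i hi y, Ext.zero_comp]

lemma right {f : A →ₗ[R] B} {g : B →ₗ[R] C} (hf : Function.Injective f)
    (hg : Function.Surjective g) (hfg : Function.Exact f g)
    (hB : ExtVanish (R := R) N d B) (hA : ExtVanish (R := R) N (d + 1) A) :
    ExtVanish (R := R) N d C := by
  intro i hi x
  obtain ⟨y, rfl⟩ := Ext.covariant_sequence_exact₃ (ModuleCat.of R N) (shortExact hf hg hfg) x
    rfl (hA (i + 1) (by omega) _)
  rw [hB i hi y, Ext.zero_comp]

lemma of_retract (f : A →ₗ[R] B) (g : B →ₗ[R] A) (hgf : g ∘ₗ f = LinearMap.id)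
    (hB : ExtVanish (R := R) N d B) : ExtVanish (R := R) N d A := by
  intro i hi x
  have h : ModuleCat.ofHom f ≫ ModuleCat.ofHom g = 𝟙 _ := by
    rw [← ModuleCat.ofHom_comp, hgf]; rfl
  rw [← Ext.comp_mk₀_id x, ← h, ← Ext.mk₀_comp_mk₀, ← Ext.comp_assoc_of_second_deg_zero,
    hB i hi (x.comp _ _), Ext.zero_comp]

lemma of_subsingleton [Subsingleton A] : ExtVanish (R := R) N d A := by
  intro i _ x
  have h : (𝟙 (ModuleCat.of R A)) = 0 := by
    ext y; exact Subsingleton.elim _ _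
  rw [← Ext.comp_mk₀_id x, h, Ext.mk₀_zero, Ext.comp_zero]

lemma prod (hA : ExtVanish (R := R) N d A) (hB : ExtVanish (R := R) N d B) :
    ExtVanish (R := R) N d (A × B) :=
  middle (LinearMap.inl_injective (R := R) (M := A) (M₂ := B)) LinearMap.snd_surjective
    (.inl_snd) hA hB

lemma pi {ι : Type} [Finite ι] {M : ι → Type u} [∀ i, AddCommGroup (M i)] [∀ i, Module R (M i)]
    (h : ∀ i, ExtVanish (R := R) N d (M i)) : ExtVanish (R := R) N d (∀ i, M i) := by
  classical
  have := Fintype.ofFinite ι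
  intro j hj x
  have hid : 𝟙 (ModuleCat.of R (∀ i, M i)) = ∑ i,
      ModuleCat.ofHom (LinearMap.proj i) ≫ ModuleCat.ofHom (LinearMap.single R M i) := by
    simp_rw [← ModuleCat.ofHom_comp]
    apply ModuleCat.hom_ext
    rw [ModuleCat.hom_sum]
    refine LinearMap.ext fun y => ?_
    simp only [ModuleCat.hom_id, LinearMap.id_coe, id_eq, ModuleCat.hom_ofHom,
      LinearMap.sum_apply, LinearMap.comp_apply, LinearMap.proj_apply, LinearMap.single_apply]
    exact (Finset.univ_sum_single y).symm
  rw [← Ext.comp_mk₀_id x, hid, Ext.mk₀_sum, Ext.comp_sum]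
  refine Finset.sum_eq_zero fun i _ => ?_
  rw [← Ext.mk₀_comp_mk₀, ← Ext.comp_assoc_of_second_deg_zero, h i j hj (x.comp _ _),
    Ext.zero_comp]

lemma smul_eq_zero {r : R} (hr : ∀ n : N, r • n = 0) {i : ℕ}
    (x : Ext (ModuleCat.of R N) (ModuleCat.of R A) i) : r • x = 0 := by
  have h : r • 𝟙 (ModuleCat.of R N) = 0 := by
    apply ModuleCat.hom_ext; ext y; exact hr y
  rw [← Ext.mk₀_id_comp x, ← Ext.smul_comp, ← Ext.mk₀_smul, h, Ext.mk₀_zero, Ext.zero_comp]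

/-- If `r` annihilates `N` and is `A`-regular, vanishing for `C = A / rA` lifts to `A`. -/
lemma of_quotient {f : A →ₗ[R] A} {g : A →ₗ[R] C} {r : R} (hr : ∀ n : N, r • n = 0)
    (hfr : ∀ a, f a = r • a) (hf : Function.Injective f)
    (hg : Function.Surjective g) (hfg : Function.Exact f g)
    (hC : ExtVanish (R := R) N d C) : ExtVanish (R := R) N (d + 1) A := by
  intro i
  have hfr' : ModuleCat.ofHom f = r • 𝟙 (ModuleCat.of R A) := by
    apply ModuleCat.hom_ext; ext y; exact hfr y
  have key (x : Ext (ModuleCat.of R N) (ModuleCat.of R A) i) :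
      x.comp (Ext.mk₀ (ModuleCat.ofHom f)) (add_zero i) = 0 := by
    rw [hfr', Ext.mk₀_smul, Ext.comp_smul, smul_eq_zero hr]
  cases i with
  | zero =>
    intro _ x
    have := Ext.postcomp_mk₀_injective_of_mono (ModuleCat.of R N) (ModuleCat.ofHom f)
      (hf := by simpa [ModuleCat.mono_iff_injective] using hf)
    exact this (by simpa using key x)
  | succ i =>
    intro hi x
    obtain ⟨y, rfl⟩ := Ext.covariant_sequence_exact₁ (ModuleCat.of R N) (shortExact hf hg hfg) x
      (key x) rfl
    rw [hC i (by omega) y, Ext.zero_comp]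

lemma subsingleton_linearMap (h : ExtVanish (R := R) N (d + 1) A) :
    Subsingleton (N →ₗ[R] A) := by
  refine subsingleton_of_forall_eq 0 fun f => ?_
  have := h 0 (by omega) (Ext.mk₀ (ModuleCat.ofHom f))
  rw [Ext.mk₀_eq_zero_iff] at this
  simpa using congrArg ModuleCat.Hom.hom this

open RingTheory.Sequence in
lemma of_isWeaklyRegular (rs : List R) (hrs : ∀ r ∈ rs, ∀ n : N, r • n = 0) (A : Type u)
    [AddCommGroup A] [Module R A] (h : IsWeaklyRegular A rs) :
    ExtVanish (R := R) N rs.length A := by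
  induction rs generalizing A with
  | nil => intro i hi; simp at hi
  | cons r rs ih =>
    rw [isWeaklyRegular_cons_iff] at h
    have := ih (fun s hs => hrs s (by simp [hs])) _ h.2
    exact of_quotient (f := LinearMap.lsmul R A r) (hrs r (by simp)) (fun _ => rfl) h.1
      (Submodule.mkQ_surjective _) (LinearMap.exact_lsmul_mkQ_smul_top A r) this

open RingTheory.Sequence in
/-- Vanishing of `Ext` produces a weakly regular sequence, which can moreover be taken in the
image under a ring endomorphism `φ` of an ideal `I`. -/
lemma exists_isWeaklyRegular [IsNoetherianRing R] {m I : Ideal R} (φ : R →+* R)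
    (hφ : ∀ p : Ideal R, p.IsPrime → I ≤ p.comap φ → m ≤ p)
    (d : ℕ) (A : Type u) [AddCommGroup A] [Module R A] [Module.Finite R A]
    (h : ExtVanish (R := R) (R ⧸ m) d A) :
    ∃ rs : List R, rs.length = d ∧ (∀ r ∈ rs, r ∈ I) ∧ IsWeaklyRegular A (rs.map φ) := by
  induction d generalizing A with
  | zero => exact ⟨[], by simp⟩
  | succ d ih =>
    have hs := h.subsingleton_linearMap
    rw [IsSMulRegular.subsingleton_linearMap_iff] at hs
    obtain ⟨r, hrm, hr⟩ := hs
    rw [Ideal.annihilator_quotient] at hrm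
    obtain ⟨y, hyI, hy⟩ : ∃ y ∈ I, IsSMulRegular A (φ y) := by
      by_contra! hcon
      have hsub : (I : Set R) ⊆ ⋃ p ∈ associatedPrimes R A, (p.comap φ : Ideal R) := by
        intro y hy
        have := biUnion_associatedPrimes_eq_compl_regular R A
        have h2 : φ y ∈ ⋃ p ∈ associatedPrimes R A, (p : Set R) := by
          rw [this]; exact hcon y hy
        simpa using h2
      rw [Ideal.subset_union_prime_finite (associatedPrimes.finite R A) ⊥ ⊥] at hsub
      · obtain ⟨p, hp, hIp⟩ := hsub
        have h3 : r ∈ p := hφ p hp.isPrime hIp hrm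
        have h4 : r ∈ ⋃ p ∈ associatedPrimes R A, (p : Set R) := by
          simp only [Set.mem_iUnion]; exact ⟨p, hp, h3⟩
        rw [biUnion_associatedPrimes_eq_compl_regular R A] at h4
        exact h4 hr
      · intro p hp _ _
        have := hp.isPrime
        exact Ideal.comap_isPrime φ p
    have hq : ExtVanish (R := R) (R ⧸ m) d (QuotSMulTop (φ y) A) :=
      right (f := LinearMap.lsmul R A (φ y)) hy
      (Submodule.mkQ_surjective _) (LinearMap.exact_lsmul_mkQ_smul_top A (φ y))
      (h.mono (by omega)) h
    obtain ⟨rs, hl, hm, hw⟩ := ih _ hq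
    refine ⟨y :: rs, by simp [hl], by simpa [hyI] using hm, ?_⟩
    rw [List.map_cons, isWeaklyRegular_cons_iff]
    exact ⟨hy, hw⟩

end ExtVanish

end Ext

namespace ExtVanish

section Ideals

variable {R : Type u} [CommRing R] {N : Type u} [AddCommGroup N] [Module R N] {d : ℕ}
variable {I I' I'' : Ideal R} {f : R}

lemma colon_exact (h' : ∀ p, p ∈ I' ↔ f * p ∈ I) (h'' : ∀ p, p ∈ I'' ↔ ∃ q, p - f * q ∈ I) :
    ∃ (φ : (R ⧸ I') →ₗ[R] R ⧸ I) (ψ : (R ⧸ I) →ₗ[R] R ⧸ I''),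
      (∀ p : R, φ (Submodule.Quotient.mk p) = Submodule.Quotient.mk (f * p)) ∧
      Function.Injective φ ∧ Function.Surjective ψ ∧ Function.Exact φ ψ := by
  have h1 : I' ≤ Submodule.comap (LinearMap.lsmul R R f) I := fun p hp => (h' p).1 hp
  have h2 : I ≤ I'' := fun p hp => (h'' p).2 ⟨0, by simpa using hp⟩
  refine ⟨Submodule.mapQ I' I _ h1, Submodule.factor h2, fun p => rfl, ?_,
    Submodule.factor_surjective h2, ?_⟩
  · rw [← LinearMap.ker_eq_bot, LinearMap.ker_eq_bot']
    intro x hx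
    obtain ⟨p, rfl⟩ := Submodule.Quotient.mk_surjective _ x
    exact (Submodule.Quotient.mk_eq_zero _).2 ((h' p).2 ((Submodule.Quotient.mk_eq_zero I).1 hx))
  · intro x
    obtain ⟨p, rfl⟩ := Submodule.Quotient.mk_surjective _ x
    have : Submodule.factor h2 (Submodule.Quotient.mk p) = Submodule.Quotient.mk p := rfl
    rw [this, Submodule.Quotient.mk_eq_zero, h'']
    constructor
    · rintro ⟨q, hq⟩
      exact ⟨Submodule.Quotient.mk q, ((Submodule.Quotient.eq I).2 hq).symm⟩
    · rintro ⟨y, hy⟩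
      obtain ⟨q, rfl⟩ := Submodule.Quotient.mk_surjective _ y
      exact ⟨q, (Submodule.Quotient.eq I).1 hy.symm⟩

lemma quotient_of_colon (h' : ∀ p, p ∈ I' ↔ f * p ∈ I)
    (h'' : ∀ p, p ∈ I'' ↔ ∃ q, p - f * q ∈ I) (hA : ExtVanish (R := R) N d (R ⧸ I'))
    (hC : ExtVanish (R := R) N d (R ⧸ I'')) : ExtVanish (R := R) N d (R ⧸ I) := by
  obtain ⟨φ, ψ, -, hφ, hψ, h⟩ := colon_exact h' h''
  exact middle hφ hψ h hA hC

lemma quotient_of_regular (h' : ∀ p, f * p ∈ I → p ∈ I)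
    (h'' : ∀ p, p ∈ I'' ↔ ∃ q, p - f * q ∈ I) (hI : ExtVanish (R := R) N (d + 1) (R ⧸ I)) :
    ExtVanish (R := R) N d (R ⧸ I'') := by
  obtain ⟨φ, ψ, -, hφ, hψ, h⟩ := colon_exact (fun p => ⟨fun hp => I.mul_mem_left f hp, h' p⟩) h''
  exact right hφ hψ h (hI.mono (by omega)) hI

lemma quotient_of_regular_succ (hf : ∀ n : N, f • n = 0) (h' : ∀ p, f * p ∈ I → p ∈ I)
    (h'' : ∀ p, p ∈ I'' ↔ ∃ q, p - f * q ∈ I) (hI : ExtVanish (R := R) N d (R ⧸ I'')) :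
    ExtVanish (R := R) N (d + 1) (R ⧸ I) := by
  obtain ⟨φ, ψ, hm, hφ, hψ, h⟩ :=
    colon_exact (fun p => ⟨fun hp => I.mul_mem_left f hp, h' p⟩) h''
  refine of_quotient hf (fun a => ?_) hφ hψ h hI
  obtain ⟨p, rfl⟩ := Submodule.Quotient.mk_surjective _ a
  exact hm p

lemma quotient_sup (hA : ExtVanish (R := R) N d (R ⧸ I)) (hB : ExtVanish (R := R) N d (R ⧸ I'))
    (hAB : ExtVanish (R := R) N (d + 1) (R ⧸ I ⊓ I')) :
    ExtVanish (R := R) N d (R ⧸ I ⊔ I') := by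
  have e1 : I ⊓ I' ≤ I := inf_le_left
  have e2 : I ⊓ I' ≤ I' := inf_le_right
  have e3 : I ≤ I ⊔ I' := le_sup_left
  have e4 : I' ≤ I ⊔ I' := le_sup_right
  refine right (f := (Submodule.factor e1).prod (Submodule.factor e2))
    (g := (Submodule.factor e3).coprod (-Submodule.factor e4)) ?_ ?_ ?_ (hA.prod hB) hAB
  · rw [← LinearMap.ker_eq_bot, LinearMap.ker_eq_bot']
    intro x hx
    obtain ⟨p, rfl⟩ := Submodule.Quotient.mk_surjective _ x
    rw [Submodule.Quotient.mk_eq_zero]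
    exact ⟨(Submodule.Quotient.mk_eq_zero I).1 (congrArg Prod.fst hx),
      (Submodule.Quotient.mk_eq_zero I').1 (congrArg Prod.snd hx)⟩
  · intro x
    obtain ⟨y, rfl⟩ := Submodule.factor_surjective e3 x
    exact ⟨(y, 0), by simp⟩
  · rintro ⟨x, y⟩
    obtain ⟨p, rfl⟩ := Submodule.Quotient.mk_surjective _ x
    obtain ⟨q, rfl⟩ := Submodule.Quotient.mk_surjective _ y
    have : ((Submodule.factor e3).coprod (-Submodule.factor e4))
        (Submodule.Quotient.mk p, Submodule.Quotient.mk q) =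
        Submodule.Quotient.mk p + -Submodule.Quotient.mk q := rfl
    rw [this, ← sub_eq_add_neg, ← Submodule.Quotient.mk_sub, Submodule.Quotient.mk_eq_zero]
    constructor
    · intro h
      obtain ⟨a, ha, b, hb, hab⟩ := Submodule.mem_sup.1 h
      refine ⟨Submodule.Quotient.mk (p - a), Prod.ext ?_ ?_⟩
      · refine (Submodule.Quotient.eq I).2 ?_
        simpa using ha
      · refine (Submodule.Quotient.eq I').2 ?_
        have : p - a - q = b := by rw [← sub_eq_iff_eq_add'.2 hab.symm]; ring
        change p - a - q ∈ I'
        rwa [this]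
    · rintro ⟨z, hz⟩
      obtain ⟨s, rfl⟩ := Submodule.Quotient.mk_surjective _ z
      have h1 : s - p ∈ I := (Submodule.Quotient.eq I).1 (congrArg Prod.fst hz)
      have h2 : s - q ∈ I' := (Submodule.Quotient.eq I').1 (congrArg Prod.snd hz)
      have : p - q = -(s - p) + (s - q) := by ring
      rw [this]
      exact Submodule.add_mem_sup (I.neg_mem h1) h2

end Ideals

end ExtVanish

section Monomial

variable {V : Type} {K : Type u} [Field K]

/-- The monomial ideal spanned by the monomials `x ^ m` such that every multiple of `x ^ m`
satisfies `P`. -/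
def monIdeal (K : Type u) [Field K] (P : (V →₀ ℕ) → Prop) : Ideal (MvPolynomial V K) where
  carrier := {p | ∀ m, p.coeff m ≠ 0 → ∀ m', m ≤ m' → P m'}
  zero_mem' := by simp
  add_mem' := by
    intro p q hp hq m hm
    by_cases h : p.coeff m = 0
    · exact hq m (by simpa [h] using hm)
    · exact hp m h
  smul_mem' := by
    classical
    intro c p hp m hm m' hmm'
    rw [smul_eq_mul, coeff_mul] at hm
    obtain ⟨x, hx, hx0⟩ := Finset.exists_ne_zero_of_sum_ne_zero hm
    refine hp x.2 (right_ne_zero_of_mul hx0) m' (le_trans ?_ hmm')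
    rw [← Finset.HasAntidiagonal.mem_antidiagonal.1 hx]
    exact le_add_self

variable {P Q : (V →₀ ℕ) → Prop}

lemma mem_monIdeal (hP : Monotone P) {p : MvPolynomial V K} :
    p ∈ monIdeal K P ↔ ∀ m, p.coeff m ≠ 0 → P m :=
  ⟨fun h m hm => h m hm m le_rfl, fun h m hm _ hmm' => hP hmm' (h m hm)⟩

lemma monomial_mem_monIdeal (hP : Monotone P) {m : V →₀ ℕ} (hm : P m) (c : K) :
    monomial m c ∈ monIdeal K P := by
  classical
  rw [mem_monIdeal hP]
  intro m' h
  rw [coeff_monomial] at h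
  obtain rfl : m = m' := by by_contra h'; simp [h'] at h
  exact hm

lemma monIdeal_mono (h : ∀ m, P m → Q m) : monIdeal K P ≤ monIdeal K Q :=
  fun _ hp m hm m' hmm' => h m' (hp m hm m' hmm')

lemma monIdeal_inf (P Q : (V →₀ ℕ) → Prop) :
    monIdeal K P ⊓ monIdeal K Q = monIdeal K fun m => P m ∧ Q m :=
  le_antisymm (fun _ hp m hm m' hmm' => ⟨hp.1 m hm m' hmm', hp.2 m hm m' hmm'⟩)
    (le_inf (monIdeal_mono fun _ h => h.1) (monIdeal_mono fun _ h => h.2))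

lemma monotone_or (hP : Monotone P) (hQ : Monotone Q) : Monotone fun m => P m ∨ Q m :=
  fun _ _ h => Or.imp (hP h) (hQ h)

lemma monotone_and (hP : Monotone P) (hQ : Monotone Q) : Monotone fun m => P m ∧ Q m :=
  fun _ _ h => And.imp (hP h) (hQ h)

lemma monotone_ge (s : V →₀ ℕ) : Monotone fun m : V →₀ ℕ => s ≤ m :=
  fun _ _ h h' => le_trans h' h

lemma monIdeal_sup (hP : Monotone P) (hQ : Monotone Q) :
    monIdeal K P ⊔ monIdeal K Q = monIdeal K fun m => P m ∨ Q m := by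
  refine le_antisymm (sup_le (monIdeal_mono fun _ h => .inl h) (monIdeal_mono fun _ h => .inr h))
    fun p hp => ?_
  rw [mem_monIdeal (monotone_or hP hQ)] at hp
  rw [p.as_sum]
  refine Submodule.sum_mem _ fun m hm => ?_
  obtain h | h := hp m (mem_support_iff.1 hm)
  · exact Ideal.mem_sup_left (monomial_mem_monIdeal hP h _)
  · exact Ideal.mem_sup_right (monomial_mem_monIdeal hQ h _)

lemma mem_monIdeal_colon (hP : Monotone P) (s : V →₀ ℕ) (p : MvPolynomial V K) :
    p ∈ monIdeal K (fun m => P (m + s)) ↔ monomial s 1 * p ∈ monIdeal K P := by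
  rw [mem_monIdeal hP, mem_monIdeal fun a b h => hP (by gcongr)]
  constructor
  · intro h m hm
    rw [coeff_monomial_mul'] at hm
    split_ifs at hm with hs
    · rw [one_mul] at hm
      simpa [tsub_add_cancel_of_le hs] using h _ hm
    · exact absurd rfl hm
  · intro h m hm
    refine h _ ?_
    rwa [add_comm, coeff_monomial_mul, one_mul]

lemma mem_monIdeal_or_ge (hP : Monotone P) (s : V →₀ ℕ) (p : MvPolynomial V K) :
    p ∈ monIdeal K (fun m => P m ∨ s ≤ m) ↔ ∃ q, p - monomial s 1 * q ∈ monIdeal K P := by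
  constructor
  · intro h
    refine ⟨p.divMonomial s, ?_⟩
    rw [sub_eq_iff_eq_add'.2 (divMonomial_add_modMonomial p s).symm, mem_monIdeal hP]
    intro m hm
    rw [mem_monIdeal (monotone_or hP (monotone_ge s))] at h
    by_cases hs : s ≤ m
    · exact absurd (coeff_modMonomial_of_le p hs) hm
    · rw [coeff_modMonomial_of_not_le p hs] at hm
      exact (h m hm).resolve_right hs
  · rintro ⟨q, hq⟩
    rw [← sub_add_cancel p (monomial s 1 * q)]
    exact add_mem (monIdeal_mono (fun _ => .inl) hq) (Ideal.mul_mem_right _ _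
      (monomial_mem_monIdeal (monotone_or hP (monotone_ge s)) (.inr le_rfl) 1))

/-- `Ext^i(K, R / I_P) = 0` for `i < d`, where `I_P` is the monomial ideal attached to `P`;
equivalently, `depth R / I_P` is at least `d`. -/
def DepthGE (K : Type u) [Field K] (P : (V →₀ ℕ) → Prop) (d : ℕ) : Prop :=
  ExtVanish (R := MvPolynomial V K)
    (MvPolynomial V K ⧸ Ideal.span (Set.range (X : V → MvPolynomial V K))) d
    (MvPolynomial V K ⧸ monIdeal K P)

namespace DepthGE

variable {d : ℕ}

lemma mono {e : ℕ} (h : DepthGE K P d) (hed : e ≤ d) : DepthGE K P e := ExtVanish.mono h hed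

lemma zero : DepthGE K P 0 := fun i hi => absurd hi (by omega)

lemma congr (h : ∀ m, P m ↔ Q m) : DepthGE K P d ↔ DepthGE K Q d := by
  rw [funext fun m => propext (h m)]

lemma of_forall (h : ∀ m, P m) : DepthGE K P d := by
  have : Subsingleton (MvPolynomial V K ⧸ monIdeal K P) :=
    Ideal.Quotient.subsingleton_iff.2 (top_le_iff.1 fun _ _ _ _ m' _ => h m')
  exact ExtVanish.of_subsingleton

lemma or_of_and (hP : Monotone P) (hQ : Monotone Q) (h1 : DepthGE K P d) (h2 : DepthGE K Q d)
    (h : DepthGE K (fun m => P m ∧ Q m) (d + 1)) : DepthGE K (fun m => P m ∨ Q m) d := by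
  unfold DepthGE at *
  rw [← monIdeal_sup hP hQ]
  rw [← monIdeal_inf] at h
  exact ExtVanish.quotient_sup h1 h2 h

lemma of_colon (hP : Monotone P) (s : V →₀ ℕ) (h1 : DepthGE K (fun m => P (m + s)) d)
    (h2 : DepthGE K (fun m => P m ∨ s ≤ m) d) : DepthGE K P d :=
  ExtVanish.quotient_of_colon (mem_monIdeal_colon hP s) (mem_monIdeal_or_ge hP s) h1 h2

lemma or_ge_iff (hP : Monotone P) {s : V →₀ ℕ} (hs : s ≠ 0) (h : ∀ m, P (m + s) → P m) :
    DepthGE K (fun m => P m ∨ s ≤ m) d ↔ DepthGE K P (d + 1) := by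
  have h' (p : MvPolynomial V K) (hp : monomial s 1 * p ∈ monIdeal K P) : p ∈ monIdeal K P :=
    monIdeal_mono h ((mem_monIdeal_colon hP s p).2 hp)
  refine ⟨ExtVanish.quotient_of_regular_succ (fun n => ?_) h' (mem_monIdeal_or_ge hP s),
    ExtVanish.quotient_of_regular h' (mem_monIdeal_or_ge hP s)⟩
  obtain ⟨q, rfl⟩ := Submodule.Quotient.mk_surjective _ n
  rw [← Submodule.Quotient.mk_smul, Submodule.Quotient.mk_eq_zero, smul_eq_mul]
  refine Ideal.mul_mem_right _ _ ?_
  obtain ⟨v, hv⟩ := Finsupp.ne_iff.1 hs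
  rw [← Set.image_univ, mem_ideal_span_X_image]
  intro m hm
  classical
  rw [support_monomial] at hm
  simp only [one_ne_zero, if_false, Finset.mem_singleton] at hm
  exact ⟨v, trivial, by simpa [hm] using hv⟩

lemma exists_ne_zero_iff [Fintype V] [DecidableEq V] (n : ℕ) :
    ∀ (S : Finset V), S.card + n = Fintype.card V → ∀ d,
      (DepthGE K (fun m => ∃ u ∈ S, m u ≠ 0) d ↔ d ≤ n) := by
  induction n with
  | zero =>
    intro S hS d
    obtain rfl : S = Finset.univ := (Finset.card_eq_iff_eq_univ S).1 hS
    have hm : monIdeal K (fun m : V →₀ ℕ => ∃ u ∈ Finset.univ, m u ≠ 0) =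
        Ideal.span (Set.range (X : V → MvPolynomial V K)) := by
      ext p
      rw [mem_monIdeal fun a b h ⟨u, hu, hau⟩ => ⟨u, hu, by have := h u; omega⟩,
        ← Set.image_univ, mem_ideal_span_X_image]
      simp
    refine ⟨fun h => ?_, fun h => by obtain rfl : d = 0 := by omega
                                     exact zero⟩
    by_contra hd
    have h1 : DepthGE K (fun m : V →₀ ℕ => ∃ u ∈ Finset.univ, m u ≠ 0) (0 + 1) :=
      h.mono (by omega)
    unfold DepthGE at h1
    rw [hm] at h1
    have h2 := ExtVanish.subsingleton_linearMap h1
    have h3 := LinearMap.congr_fun (h2.elim LinearMap.id 0)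
      (Submodule.Quotient.mk (1 : MvPolynomial V K))
    rw [LinearMap.id_apply, LinearMap.zero_apply, Submodule.Quotient.mk_eq_zero, ← hm,
      mem_monIdeal fun a b h ⟨u, hu, hau⟩ => ⟨u, hu, by have := h u; omega⟩] at h3
    simpa using h3 0 (by simp)
  | succ n ih =>
    intro S hS d
    obtain ⟨v, hv⟩ : ∃ v, v ∉ S := by
      by_contra! hcon
      rw [Finset.eq_univ_of_forall hcon, Finset.card_univ] at hS
      omega
    cases d with
    | zero => simp [zero]
    | succ d =>
      rw [← or_ge_iff (s := Finsupp.single v 1) ?_ (by simp), Nat.add_le_add_iff_right,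
        ← ih (insert v S), congr]
      · simp [Nat.one_le_iff_ne_zero, or_comm, eq_comm]
      · rw [Finset.card_insert_of_notMem hv]; omega
      · rintro m ⟨u, hu, hmu⟩
        refine ⟨u, hu, ?_⟩
        rwa [Finsupp.add_apply, Finsupp.single_eq_of_ne (by rintro rfl; exact hv hu)] at hmu
      · exact fun a b h ⟨u, hu, hau⟩ => ⟨u, hu, by have := h u; omega⟩

lemma of_false [Fintype V] (h : ∀ m, ¬ P m) (hd : d ≤ Fintype.card V) : DepthGE K P d := by
  classical
  rw [← exists_ne_zero_iff (K := K) (Fintype.card V) (∅ : Finset V) (by simp)] at hd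
  exact (congr (by simpa using h)).1 hd

/-- Lower bound for the depth obtained by splitting with respect to the variable `v`: the colon
ideal is given by `P₁`, and modulo `v` the ideal is `x ^ s` times the one given by `P₂`. -/
lemma step [Fintype V] {P₁ P₂ : (V →₀ ℕ) → Prop} (hP : Monotone P) (hP₂ : Monotone P₂) (v : V)
    (s : V →₀ ℕ) (hs : s ≠ 0) (hsv : s v = 0) (h1 : ∀ m, P (m + Finsupp.single v 1) ↔ P₁ m)
    (h2 : ∀ m, m v = 0 → (P m ↔ P₂ m ∧ s ≤ m)) (h2v : ∀ m, P₂ (m + Finsupp.single v 1) → P₂ m)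
    (h2s : ∀ m, P₂ (m + s) → P₂ m) (hd : d + 2 ≤ Fintype.card V)
    (hd1 : DepthGE K P₁ d) (hd2 : DepthGE K P₂ (d + 1)) : DepthGE K P d := by
  have hL : Monotone fun m => P₂ m ∧ s ≤ m := monotone_and hP₂ (monotone_ge s)
  have hv (m : V →₀ ℕ) : Finsupp.single v 1 ≤ m ↔ m v ≠ 0 := by
    rw [Finsupp.single_le_iff, Nat.one_le_iff_ne_zero]
  refine of_colon hP (Finsupp.single v 1) ((congr h1).2 hd1) ?_
  rw [congr (Q := fun m => (P₂ m ∧ s ≤ m) ∨ Finsupp.single v 1 ≤ m)]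
  · rw [or_ge_iff hL (by simp)]
    · refine of_colon hL s ?_ ?_
      · refine (congr fun m => ?_).2 hd2
        exact ⟨fun h => h2s m h.1, fun h => ⟨hP₂ le_self_add h, le_add_self⟩⟩
      · have h0 : DepthGE K (fun m : V →₀ ℕ => False) (d + 1 + 1) := of_false (by simp) hd
        rw [← or_ge_iff monotone_const hs (by simp)] at h0
        exact (congr fun m => by tauto).1 h0
    · rintro m ⟨h, hm⟩
      refine ⟨h2v m h, fun u => ?_⟩
      by_cases huv : u = v
      · rw [huv, hsv]; exact Nat.zero_le _
      · simpa [Finsupp.single_eq_of_ne huv] using hm u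
  · intro m
    rw [hv]
    by_cases hm : m v = 0
    · simp [hm, h2 m hm]
    · simp [hm]

end DepthGE

end Monomial

section Path

/-- A family of `t` indices `i ≥ a` in `E`, each being followed by a gap of at least three, or of
at least two if the next index is not in `E`. -/
def Chain (E : ℕ → Prop) : ℕ → ℕ → Prop
  | 0, _ => True
  | t + 1, a => ∃ i, a ≤ i ∧ E i ∧ (Chain E t (i + 3) ∨ ¬ E (i + 1) ∧ Chain E t (i + 2))

namespace Chain

variable {E E' : ℕ → Prop}

lemma anti {t a b : ℕ} (hab : a ≤ b) (h : Chain E t b) : Chain E t a := by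
  cases t with
  | zero => trivial
  | succ t =>
    obtain ⟨i, hi, h⟩ := h
    exact ⟨i, hab.trans hi, h⟩

lemma congr {t a : ℕ} (hE : ∀ i, a ≤ i → (E i ↔ E' i)) (h : Chain E t a) : Chain E' t a := by
  induction t generalizing a with
  | zero => trivial
  | succ t ih =>
    obtain ⟨i, hi, hEi, h⟩ := h
    refine ⟨i, hi, (hE i hi).1 hEi, h.imp ?_ ?_⟩
    · exact ih fun j hj => hE j (by omega)
    · exact And.imp (by rw [hE _ (by omega)]; exact id) (ih fun j hj => hE j (by omega))

end Chain

variable {V : Type} {K : Type u} [Field K]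

/-- The exponent vectors of the monomials in `⋂ i ∈ E, (x (l i), x (l (i + 1)))`. -/
def LabPred (l : ℕ → V) (E : ℕ → Prop) (m : V →₀ ℕ) : Prop :=
  ∀ i, E i → m (l i) ≠ 0 ∨ m (l (i + 1)) ≠ 0

lemma labPred_mono (l : ℕ → V) (E : ℕ → Prop) : Monotone (LabPred l E) := by
  intro a b hab h i hi
  have h1 := hab (l i)
  have h2 := hab (l (i + 1))
  have := h i hi
  omega

lemma labPred_add_iff (l : ℕ → V) (E : ℕ → Prop) (m s : V →₀ ℕ) :
    LabPred l E (m + s) ↔ LabPred l (fun i => E i ∧ s (l i) = 0 ∧ s (l (i + 1)) = 0) m := by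
  refine forall_congr' fun i => ?_
  simp only [Finsupp.add_apply]
  by_cases hE : E i
  · simp only [hE, true_and, true_imp_iff]
    omega
  · simp [hE]

lemma labPred_anti (l : ℕ → V) {E E' : ℕ → Prop} (h : ∀ i, E i → E' i) {m : V →₀ ℕ}
    (hm : LabPred l E' m) : LabPred l E m := fun i hi => hm i (h i hi)

lemma labPred_congr (l : ℕ → V) {E E' : ℕ → Prop} (h : ∀ i, E i ↔ E' i) (m : V →₀ ℕ) :
    LabPred l E m ↔ LabPred l E' m := by rw [funext fun i => propext (h i)]

lemma single_le_iff_ne_zero (v : V) (m : V →₀ ℕ) : Finsupp.single v 1 ≤ m ↔ m v ≠ 0 := by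
  rw [Finsupp.single_le_iff, Nat.one_le_iff_ne_zero]

lemma single_add_single_le_iff [DecidableEq V] {v w : V} (h : v ≠ w) (m : V →₀ ℕ) :
    Finsupp.single v 1 + Finsupp.single w 1 ≤ m ↔ m v ≠ 0 ∧ m w ≠ 0 := by
  constructor
  · intro hm
    have h1 := hm v
    have h2 := hm w
    simp [h, h.symm] at h1 h2
    omega
  · rintro ⟨h1, h2⟩ u
    simp only [Finsupp.add_apply, Finsupp.single_apply]
    split_ifs with h3 h4 h4
    · exact absurd (h3.trans h4.symm) h
    · subst h3; omega
    · subst h4; omega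
    · omega

lemma single_apply_eq_zero_iff [DecidableEq V] (v w : V) : Finsupp.single v 1 w = 0 ↔ v ≠ w := by
  simp [Finsupp.single_apply]

/-- Depth of the cover ideal of a disjoint union of paths. -/
lemma depthGE_path [Fintype V] [DecidableEq V] {r : ℕ} (hr : Fintype.card V = r) (l : ℕ → V)
    (hl : ∀ i j, i < r → j < r → l i = l j → i = j) (b : ℕ) (hb : b + 1 ≤ r) (n : ℕ) :
    ∀ (a s d : ℕ) (E : ℕ → Prop), b ≤ a + n → (∀ i, E i → a ≤ i ∧ i < b) →
      ¬ Chain E (s + 1) a → d + s + 1 ≤ r → DepthGE K (LabPred l E) d := by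
  induction n with
  | zero =>
    intro a s d E hba hE _ _
    exact DepthGE.of_forall fun m i hi => by have := hE i hi; omega
  | succ n ih =>
    intro a s d E hba hE hc hd
    by_cases ha : E a
    · have hab := hE a ha
      have hs : s ≠ 0 := by
        rintro rfl
        exact hc ⟨a, le_rfl, ha, .inl trivial⟩
      obtain ⟨s, rfl⟩ := Nat.exists_eq_succ_of_ne_zero hs
      have key {i j : ℕ} (hi : i < r) (hj : j < r) : l i = l j ↔ i = j :=
        ⟨hl i j hi hj, fun h => by rw [h]⟩
      have hI : DepthGE K (LabPred l fun i => E i ∧ a + 2 ≤ i) d := by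
        refine ih (a + 2) (s + 1) d _ (by omega) (fun i hi => ⟨hi.2, (hE i hi.1).2⟩)
          (fun h => ?_) hd
        exact hc (.anti (by omega : a ≤ a + 2) (h.congr fun i hi => by simp [hi]))
      have h1 (m : V →₀ ℕ) : LabPred l E (m + Finsupp.single (l (a + 1)) 1) ↔
          LabPred l (fun i => E i ∧ a + 2 ≤ i) m := by
        rw [labPred_add_iff]
        refine labPred_congr l (fun i => and_congr_right fun hi => ?_) m
        have := hE i hi
        rw [single_apply_eq_zero_iff, single_apply_eq_zero_iff, Ne, Ne, key, key] <;> omega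
      by_cases ha1 : E (a + 1)
      · have hab1 := hE _ ha1
        have hne : l a ≠ l (a + 1) := fun h => by rw [key] at h <;> omega
        have hne2 : l (a + 2) ≠ l (a + 1) := fun h => by rw [key] at h <;> omega
        refine DepthGE.step (P₂ := LabPred l fun i => E i ∧ a + 3 ≤ i) (labPred_mono _ _)
          (labPred_mono _ _) (l (a + 1)) (Finsupp.single (l a) 1 + Finsupp.single (l (a + 2)) 1)
          (by simp) ?_ h1 ?_ ?_ ?_ (by omega) hI ?_
        · simp [hne, hne2]
        · intro m hm
          rw [single_add_single_le_iff fun h => by rw [key] at h <;> omega]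
          constructor
          · intro h
            refine ⟨labPred_anti l (fun i hi => hi.1) h, ?_, ?_⟩
            · exact (h a ha).resolve_right (by simpa using hm)
            · exact (h _ ha1).resolve_left (by simpa using hm)
          · rintro ⟨h, h3, h4⟩ i hi
            have := hE i hi
            obtain rfl | rfl | h5 : i = a ∨ i = a + 1 ∨ a + 3 ≤ i ∨ i = a + 2 := by omega
            · exact .inl h3
            · exact .inr h4
            · obtain h5 | rfl := h5
              · exact h i ⟨hi, h5⟩
              · exact .inl h4
        · intro m h
          rw [labPred_add_iff] at h
          refine labPred_anti l (fun i hi => ⟨hi, ?_⟩) h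
          have := hE i hi.1
          rw [single_apply_eq_zero_iff, single_apply_eq_zero_iff, Ne, Ne, key, key] <;> omega
        · intro m h
          rw [labPred_add_iff] at h
          refine labPred_anti l (fun i hi => ⟨hi, ?_⟩) h
          have := hE i hi.1
          simp only [Finsupp.add_apply, Nat.add_eq_zero_iff, single_apply_eq_zero_iff, Ne]
          rw [key, key, key, key] <;> omega
        · refine ih (a + 3) s (d + 1) _ (by omega) (fun i hi => ⟨hi.2, (hE i hi.1).2⟩)
            (fun h => ?_) (by omega)
          exact hc ⟨a, le_rfl, ha, .inl (h.congr fun i hi => by simp [hi])⟩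
      · refine DepthGE.step (P₂ := LabPred l fun i => E i ∧ a + 2 ≤ i) (labPred_mono _ _)
          (labPred_mono _ _) (l (a + 1)) (Finsupp.single (l a) 1)
          (by simp) ?_ h1 ?_ ?_ ?_ (by omega) hI ?_
        · rw [single_apply_eq_zero_iff, Ne, key] <;> omega
        · intro m hm
          rw [single_le_iff_ne_zero]
          constructor
          · intro h
            exact ⟨labPred_anti l (fun i hi => hi.1) h, (h a ha).resolve_right (by simpa using hm)⟩
          · rintro ⟨h, h3⟩ i hi
            have := hE i hi
            obtain rfl | rfl | h5 : i = a ∨ i = a + 1 ∨ a + 2 ≤ i := by omega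
            · exact .inl h3
            · exact absurd hi ha1
            · exact h i ⟨hi, h5⟩
        · intro m h
          rw [labPred_add_iff] at h
          refine labPred_anti l (fun i hi => ⟨hi, ?_⟩) h
          have := hE i hi.1
          rw [single_apply_eq_zero_iff, single_apply_eq_zero_iff, Ne, Ne, key, key] <;> omega
        · intro m h
          rw [labPred_add_iff] at h
          refine labPred_anti l (fun i hi => ⟨hi, ?_⟩) h
          have := hE i hi.1
          rw [single_apply_eq_zero_iff, single_apply_eq_zero_iff, Ne, Ne, key, key] <;> omega
        · refine ih (a + 2) s (d + 1) _ (by omega) (fun i hi => ⟨hi.2, (hE i hi.1).2⟩)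
            (fun h => ?_) (by omega)
          exact hc ⟨a, le_rfl, ha, .inr ⟨ha1, h.congr fun i hi => by simp [hi]⟩⟩
    · refine ih (a + 1) s d E (by omega) (fun i hi => ?_) (fun h => hc (h.anti (by omega))) hd
      have := hE i hi
      have : i ≠ a := by rintro rfl; exact ha hi
      omega

end Path

namespace Chain

variable {E : ℕ → Prop} {b : ℕ}

lemma two_mul_add_le (hE : ∀ i, E i → i < b) (t : ℕ) :
    ∀ a, Chain E (t + 1) a → 2 * (t + 1) + a ≤ b + 1 := by
  induction t with
  | zero =>
    rintro a ⟨i, hi, hEi, -⟩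
    have := hE i hEi
    omega
  | succ t ih =>
    rintro a ⟨i, hi, -, h | ⟨-, h⟩⟩
    · have := ih _ h
      omega
    · have := ih _ h
      omega

lemma three_mul_add_le (hE : ∀ i, E i → i < b) (t : ℕ) :
    ∀ a, (∀ i, a ≤ i → i < b → E i) → Chain E (t + 1) a → 3 * (t + 1) + a ≤ b + 2 := by
  induction t with
  | zero =>
    rintro a - ⟨i, hi, hEi, -⟩
    have := hE i hEi
    omega
  | succ t ih =>
    rintro a hE' ⟨i, hi, -, h | ⟨h1, h⟩⟩
    · have := ih _ (fun j hj => hE' j (by omega)) h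
      omega
    · have := two_mul_add_le hE _ _ h
      exact absurd (hE' (i + 1) (by omega) (by omega)) h1

variable {α : ℕ → ℕ} {n : ℕ}

lemma weight_le (hE : ∀ i, E i → i < b) (t : ℕ) :
    ∀ a, (∀ i, a ≤ i → i < b → (E i ↔ α i + α (i + 1) < n)) → 2 * (t + 1) + a = b + 1 →
      Chain E (t + 1) a → α a + α b + (t + 1) ≤ n := by
  induction t with
  | zero =>
    rintro a hα hb ⟨i, hi, hEi, -⟩
    have := hE i hEi
    obtain rfl : i = a := by omega
    obtain rfl : b = i + 1 := by omega
    have := (hα i hi (by omega)).1 hEi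
    omega
  | succ t ih =>
    rintro a hα hb ⟨i, hi, hEi, h | ⟨h1, h⟩⟩
    · have := two_mul_add_le hE _ _ h
      omega
    · have := two_mul_add_le hE _ _ h
      obtain rfl : i = a := by omega
      have h2 := ih _ (fun j hj => hα j (by omega)) (by omega) h
      rw [hα i le_rfl (by omega)] at hEi
      rw [hα (i + 1) (by omega) (by omega)] at h1
      rw [show i + 1 + 1 = i + 2 from rfl] at h1
      omega

lemma weight_le_of_slack (hE : ∀ i, E i → i < b) (t : ℕ) :
    ∀ a, (∀ i, a ≤ i → i < b → (E i ↔ α i + α (i + 1) < n)) → 2 * (t + 1) + a = b →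
      Chain E (t + 1) a →
      α b + (t + 1) ≤ n ∨ α a + (t + 1) ≤ n ∨ α a + α b + (t + 1) ≤ 2 * n := by
  induction t with
  | zero =>
    rintro a hα hb ⟨i, hi, hEi, -⟩
    have h1 := hE i hEi
    have h2 := (hα i hi (by omega)).1 hEi
    obtain rfl | rfl : i = a ∨ i = a + 1 := by omega
    · omega
    · obtain rfl : b = a + 1 + 1 := by omega
      omega
  | succ t ih =>
    rintro a hα hb ⟨i, hi, hEi, h⟩
    have h0 : i ≤ a + 1 := by
      obtain h | ⟨-, h⟩ := h
      · have := two_mul_add_le hE _ _ h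
        omega
      · have := two_mul_add_le hE _ _ h
        omega
    obtain rfl | rfl : i = a + 1 ∨ i = a := by omega
    · have := weight_le (α := α) (n := n) hE (t + 1) (a + 1) (fun j hj => hα j (by omega))
        (by omega) ⟨a + 1, le_rfl, hEi, h⟩
      omega
    · have h3 := (hα i hi (by omega)).1 hEi
      obtain h | ⟨h1, h⟩ := h
      · have := weight_le (α := α) (n := n) hE t (i + 3) (fun j hj => hα j (by omega))
          (by omega) h
        omega
      · have := ih (i + 2) (fun j hj => hα j (by omega)) (by omega) h
        rw [hα (i + 1) (by omega) (by omega), show i + 1 + 1 = i + 2 from rfl] at h1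
        omega

end Chain

section Cycle

variable {K : Type u} [Field K] {r : ℕ}

/-- The vertex of the `r`-cycle reached from `c` after `i` steps. -/
def cycLab (r : ℕ) [NeZero r] (c i : ℕ) : Fin r := Fin.ofNat r (i + c)

lemma cycLab_injOn [NeZero r] (c i j : ℕ) (hi : i < r) (hj : j < r)
    (h : cycLab r c i = cycLab r c j) : i = j := by
  have h1 : (i + c) % r = (j + c) % r := congrArg Fin.val h
  have h2 : i ≡ j [MOD r] := Nat.ModEq.add_right_cancel' c h1
  exact h2.eq_of_lt_of_lt hi hj

lemma cycLab_add_self [NeZero r] (c i : ℕ) : cycLab r c (i + r) = cycLab r c i := by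
  ext
  change (i + r + c) % r = (i + c) % r
  rw [show i + r + c = i + c + r by ring, Nat.add_mod_right]

lemma exists_cycLab_eq [NeZero r] (c : ℕ) (u : Fin r) : ∃ i < r, cycLab r c i = u := by
  obtain ⟨i, hi⟩ : ∃ i, (fun i : Fin r => cycLab r c i) i = u :=
    (Finite.injective_iff_surjective.1 fun i j h =>
      Fin.ext (cycLab_injOn c i j i.2 j.2 h)) u
  exact ⟨i, i.2, hi⟩

lemma cycleGraph_adj_iff_cycLab [NeZero r] (hr : 2 ≤ r) (c : ℕ) (u v : Fin r) :
    (SimpleGraph.cycleGraph r).Adj u v ↔ ∃ i < r,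
      u = cycLab r c i ∧ v = cycLab r c (i + 1) ∨ v = cycLab r c i ∧ u = cycLab r c (i + 1) := by
  have key (u v : Fin r) : (v - u).val = 1 ↔
      ∃ i < r, u = cycLab r c i ∧ v = cycLab r c (i + 1) := by
    have h1 : (v - u).val = 1 ↔ v = u + Fin.ofNat r 1 := by
      rw [← sub_eq_iff_eq_add', Fin.ext_iff]
      simp [Nat.mod_eq_of_lt hr]
    have h2 (i : ℕ) : cycLab r c (i + 1) = cycLab r c i + Fin.ofNat r 1 := by
      ext
      simp [cycLab, Fin.val_add, add_right_comm]
    rw [h1]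
    constructor
    · rintro rfl
      obtain ⟨i, hi, rfl⟩ := exists_cycLab_eq c u
      exact ⟨i, hi, rfl, (h2 i).symm⟩
    · rintro ⟨i, -, rfl, rfl⟩
      exact h2 i
  rw [SimpleGraph.cycleGraph_adj', key, key, ← exists_or]
  refine exists_congr fun i => ?_
  tauto

/-- The exponent vectors of the monomials in `⋂ (x u, x v)`, over the edges `{u, v}` of the
`r`-cycle such that `ρ u + ρ v < n`. -/
def CyclePred (n : ℕ) (ρ : Fin r → ℕ) (m : Fin r →₀ ℕ) : Prop :=
  ∀ u v, (SimpleGraph.cycleGraph r).Adj u v → ρ u + ρ v < n → m u ≠ 0 ∨ m v ≠ 0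

lemma cyclePred_iff [NeZero r] (hr : 2 ≤ r) (n : ℕ) (ρ : Fin r → ℕ) (c : ℕ) (m : Fin r →₀ ℕ) :
    CyclePred n ρ m ↔
      LabPred (cycLab r c) (fun i => i < r ∧ ρ (cycLab r c i) + ρ (cycLab r c (i + 1)) < n) m := by
  constructor
  · rintro h i ⟨hi, hρ⟩
    exact h _ _ ((cycleGraph_adj_iff_cycLab hr c _ _).2 ⟨i, hi, .inl ⟨rfl, rfl⟩⟩) hρ
  · intro h u v huv hρ
    obtain ⟨i, hi, ⟨rfl, rfl⟩ | ⟨rfl, rfl⟩⟩ := (cycleGraph_adj_iff_cycLab hr c _ _).1 huv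
    · exact h i ⟨hi, hρ⟩
    · exact (h i ⟨hi, by omega⟩).symm

variable {k n : ℕ}

lemma depthGE_of_proper [NeZero r] (hr : 2 ≤ r) (ρ : Fin r → ℕ) (s d : ℕ) (hd : d + s + 1 ≤ r)
    (h : ∃ u v, (SimpleGraph.cycleGraph r).Adj u v ∧ n ≤ ρ u + ρ v)
    (hs : ∀ α : ℕ → ℕ, n ≤ α 0 + α (r - 1) →
      ¬ Chain (fun i => i < r - 1 ∧ α i + α (i + 1) < n) (s + 1) 0) :
    DepthGE K (CyclePred n ρ) d := by
  obtain ⟨c, hc⟩ : ∃ c, n ≤ ρ (cycLab r c 0) + ρ (cycLab r c (r - 1)) := by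
    obtain ⟨u, v, huv, hn⟩ := h
    have h1 (i : ℕ) : cycLab r (i + 1) 0 = cycLab r 0 (i + 1) := by simp [cycLab]
    have h2 (i : ℕ) : cycLab r (i + 1) (r - 1) = cycLab r 0 i := by
      rw [← cycLab_add_self 0 i]
      simp only [cycLab]
      congr 1
      omega
    obtain ⟨i, hi, ⟨rfl, rfl⟩ | ⟨rfl, rfl⟩⟩ := (cycleGraph_adj_iff_cycLab hr 0 _ _).1 huv
    · exact ⟨i + 1, by rw [h1, h2]; omega⟩
    · exact ⟨i + 1, by rw [h1, h2]; omega⟩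
  refine (DepthGE.congr fun m => ?_).2 <| depthGE_path (Fintype.card_fin r) (cycLab r c)
    (cycLab_injOn c) (r - 1) (by omega) r 0 s d
    (fun i => i < r - 1 ∧ ρ (cycLab r c i) + ρ (cycLab r c (i + 1)) < n) (by omega)
    (fun i hi => ⟨Nat.zero_le _, hi.1⟩) (hs (fun i => ρ (cycLab r c i)) hc) hd
  rw [cyclePred_iff hr n ρ c]
  refine labPred_congr _ (fun i => ?_) m
  constructor
  · rintro ⟨hi, h⟩
    refine ⟨?_, h⟩
    by_contra hi'
    obtain rfl : i = r - 1 := by omega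
    have h3 : cycLab r c (r - 1 + 1) = cycLab r c 0 := by
      rw [← cycLab_add_self c 0]
      congr 1
      omega
    rw [h3] at h
    omega
  · exact fun h => ⟨by omega, h.2⟩

lemma depthGE_of_full [NeZero r] (hr : 3 ≤ r) (ρ : Fin r → ℕ) (s d : ℕ) (hd : d + (s + 1) + 1 ≤ r)
    (h : ∀ u v, (SimpleGraph.cycleGraph r).Adj u v → ρ u + ρ v < n)
    (hs1 : ¬ Chain (fun i => 1 ≤ i ∧ i < r - 1) (s + 2) 1)
    (hs2 : ¬ Chain (fun i => 2 ≤ i ∧ i < r - 2) (s + 1) 2) :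
    DepthGE K (CyclePred n ρ) d := by
  have hc (m : Fin r →₀ ℕ) : CyclePred n ρ m ↔ LabPred (cycLab r 0) (fun i => i < r) m := by
    rw [cyclePred_iff (by omega) n ρ 0]
    refine labPred_congr _ (fun i => and_iff_left_of_imp fun hi => h _ _ ?_) m
    exact (cycleGraph_adj_iff_cycLab (by omega) 0 _ _).2 ⟨i, hi, .inl ⟨rfl, rfl⟩⟩
  rw [DepthGE.congr hc]
  have key {i j : ℕ} (hi : i < r) (hj : j < r) : cycLab r 0 i = cycLab r 0 j ↔ i = j :=
    ⟨cycLab_injOn 0 i j hi hj, fun h => by rw [h]⟩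
  have h3 : cycLab r 0 (r - 1 + 1) = cycLab r 0 0 := by
    rw [← cycLab_add_self 0 0]
    congr 1
    omega
  have hne1 : cycLab r 0 1 ≠ cycLab r 0 0 := fun h => by rw [key] at h <;> omega
  have hne2 : cycLab r 0 (r - 1) ≠ cycLab r 0 0 := fun h => by rw [key] at h <;> omega
  have hne3 : cycLab r 0 1 ≠ cycLab r 0 (r - 1) := fun h => by rw [key] at h <;> omega
  have key0 {i : ℕ} (hi : i < r) (h1 : 1 ≤ i) : cycLab r 0 (i + 1) = cycLab r 0 0 ↔ i = r - 1 := by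
    by_cases h : i = r - 1
    · rw [h, h3]; simp
    · rw [key] <;> omega
  refine DepthGE.step (P₁ := LabPred (cycLab r 0) fun i => 1 ≤ i ∧ i < r - 1)
    (P₂ := LabPred (cycLab r 0) fun i => 2 ≤ i ∧ i < r - 2) (labPred_mono _ _)
    (labPred_mono _ _) (cycLab r 0 0)
    (Finsupp.single (cycLab r 0 1) 1 + Finsupp.single (cycLab r 0 (r - 1)) 1)
    (by simp) (by simp [hne1, hne2]) ?_ ?_ ?_ ?_ ?_ ?_ ?_
  · intro m
    rw [labPred_add_iff]
    refine labPred_congr _ (fun i => ?_) m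
    rw [single_apply_eq_zero_iff, single_apply_eq_zero_iff]
    constructor
    · rintro ⟨hi, h1, h2⟩
      have h4 : i ≠ 0 := by rintro rfl; exact h1 rfl
      refine ⟨by omega, ?_⟩
      have := (key0 hi (by omega)).not.1 (Ne.symm h2)
      omega
    · rintro ⟨h1, h2⟩
      refine ⟨by omega, fun h => ?_, fun h => ?_⟩
      · rw [key] at h <;> omega
      · have := (key0 (by omega) h1).1 h.symm
        omega
  · intro m hm
    rw [single_add_single_le_iff hne3]
    constructor
    · intro h
      refine ⟨labPred_anti _ (fun i hi => by omega) h, ?_, ?_⟩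
      · exact (h 0 (by omega)).resolve_left (by simpa using hm)
      · refine (h (r - 1) (by omega)).resolve_right ?_
        rw [h3]
        simpa using hm
    · rintro ⟨h, h4, h5⟩ i hi
      by_cases h6 : i = 0
      · subst h6; exact .inr h4
      by_cases h7 : i = 1
      · subst h7; exact .inl h4
      by_cases h8 : i = r - 1
      · subst h8; exact .inl h5
      by_cases h9 : i = r - 2
      · subst h9
        rw [show r - 2 + 1 = r - 1 by omega]
        exact .inr h5
      exact h i (by omega)
  · intro m h
    rw [labPred_add_iff] at h
    refine labPred_anti _ (fun i hi => ⟨hi, ?_⟩) h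
    rw [single_apply_eq_zero_iff, single_apply_eq_zero_iff, Ne, Ne, key, key] <;> omega
  · intro m h
    rw [labPred_add_iff] at h
    refine labPred_anti _ (fun i hi => ⟨hi, ?_⟩) h
    simp only [Finsupp.add_apply, Nat.add_eq_zero_iff, single_apply_eq_zero_iff, Ne]
    rw [key, key, key, key] <;> omega
  · rw [Fintype.card_fin]; omega
  · exact depthGE_path (Fintype.card_fin r) _ (cycLab_injOn 0) (r - 1) (by omega) r 1 (s + 1) d
      _ (by omega) (fun i hi => hi) hs1 hd
  · exact depthGE_path (Fintype.card_fin r) _ (cycLab_injOn 0) (r - 2) (by omega) r 2 s (d + 1)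
      _ (by omega) (fun i hi => hi) hs2 (by omega)

lemma depthGE_cyclePred [NeZero r] (hk : 1 ≤ k) (hr : r = 2 * k + 1) (n : ℕ) (ρ : Fin r → ℕ) :
    DepthGE K (CyclePred n ρ) k := by
  by_cases h : ∃ u v, (SimpleGraph.cycleGraph r).Adj u v ∧ n ≤ ρ u + ρ v
  · refine depthGE_of_proper (by omega) ρ k k (by omega) h fun α _ hc => ?_
    have := hc.two_mul_add_le (b := r - 1) (fun i hi => hi.1)
    omega
  · push Not at h
    obtain ⟨s, rfl⟩ : ∃ s, k = s + 1 := ⟨k - 1, by omega⟩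
    refine depthGE_of_full (by omega) ρ s _ (by omega) h (fun hc => ?_) fun hc => ?_
    · have := hc.two_mul_add_le (b := r - 1) (fun i hi => hi.2)
      omega
    · have := hc.two_mul_add_le (b := r - 2) (fun i hi => hi.2)
      omega

lemma depthGE_cyclePred_succ [NeZero r] (hk : 3 ≤ k) (hr : r = 2 * k + 1) (ρ : Fin r → ℕ) :
    DepthGE K (CyclePred (k - 1) ρ) (k + 1) := by
  obtain ⟨s, rfl⟩ : ∃ s, k = s + 2 := ⟨k - 2, by omega⟩
  by_cases h : ∃ u v, (SimpleGraph.cycleGraph r).Adj u v ∧ s + 2 - 1 ≤ ρ u + ρ v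
  · refine depthGE_of_proper (by omega) ρ (s + 1) _ (by omega) h fun α hα hc => ?_
    have := hc.weight_le_of_slack (b := r - 1) (α := α) (n := s + 2 - 1) (fun i hi => hi.1)
      (s + 1) 0 (fun i _ hi => and_iff_right hi) (by omega)
    omega
  · push Not at h
    obtain ⟨s, rfl⟩ : ∃ s', s = s' + 1 := ⟨s - 1, by omega⟩
    refine depthGE_of_full (by omega) ρ (s + 1) _ (by omega) h (fun hc => ?_) fun hc => ?_
    · have := hc.three_mul_add_le (b := r - 1) (fun i hi => hi.2) _ _ fun i h1 h2 => ⟨h1, h2⟩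
      omega
    · have := hc.three_mul_add_le (b := r - 2) (fun i hi => hi.2) _ _ fun i h1 h2 => ⟨h1, h2⟩
      omega

end Cycle

section Sharp

variable {V : Type} [Fintype V] [DecidableEq V] {K : Type u} [Field K] {r : ℕ}

lemma depthGE_evenEdges (hr : Fintype.card V = r) (l : ℕ → V)
    (hl : ∀ i j, i < r → j < r → l i = l j → i = j) (j : ℕ) (hj : 2 * j + 1 ≤ r) :
    DepthGE K (LabPred l fun i => i < 2 * j ∧ Even i) (r - 1 - j) := by
  refine depthGE_path hr l hl (2 * j) hj (2 * j) 0 j _ _ (by omega) (fun i hi => by omega)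
    (fun hc => ?_) (by omega)
  have := hc.two_mul_add_le (b := 2 * j) (fun i hi => hi.1)
  omega

/-- The cover ideal of `j ≥ 1` disjoint edges has depth less than `r - j`. -/
lemma not_depthGE_evenEdges (hr : Fintype.card V = r) (l : ℕ → V)
    (hl : ∀ i j, i < r → j < r → l i = l j → i = j) (j : ℕ) (hj : 2 * (j + 1) + 1 ≤ r) :
    ¬ DepthGE K (LabPred l fun i => i < 2 * (j + 1) ∧ Even i) (r - (j + 1)) := by
  have key {i j : ℕ} (hi : i < r) (hj : j < r) : l i = l j ↔ i = j :=
    ⟨hl i j hi hj, fun h => by rw [h]⟩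
  have hpair (i : ℕ) (hi : i + 1 < r) (d : ℕ) :
      DepthGE K (fun m : V →₀ ℕ => m (l i) ≠ 0 ∨ m (l (i + 1)) ≠ 0) d ↔ d ≤ r - 2 := by
    rw [← DepthGE.exists_ne_zero_iff (K := K) (r - 2) {l i, l (i + 1)} ?_ d]
    · simp
    · rw [Finset.card_pair (fun h => by rw [key] at h <;> omega)]
      omega
  induction j with
  | zero =>
    intro h
    have := (hpair 0 (by omega) (r - 1)).1 ((DepthGE.congr fun m => ?_).1 h)
    · omega
    · refine ⟨fun h => h 0 (by simp), fun h i hi => ?_⟩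
      obtain rfl : i = 0 := by
        obtain ⟨h1, c, rfl⟩ := hi
        omega
      exact h
  | succ j ih =>
    intro h
    refine ih (by omega) ?_
    have h1 : DepthGE K (LabPred l fun i => i < 2 * (j + 1) ∧ Even i) (r - 1 - (j + 1)) :=
      depthGE_evenEdges hr l hl (j + 1) (by omega)
    have h2 := (hpair (2 * (j + 1)) (by omega) (r - 2)).2 le_rfl
    have hQ : Monotone fun m : V →₀ ℕ => m (l (2 * (j + 1))) ≠ 0 ∨ m (l (2 * (j + 1) + 1)) ≠ 0 :=
      fun a b hab h => by
        have h1 := hab (l (2 * (j + 1)))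
        have h2 := hab (l (2 * (j + 1) + 1))
        omega
    have h3 := DepthGE.or_of_and (d := r - (j + 1) - 2) (labPred_mono _ _) hQ
      (h1.mono (by omega)) (h2.mono (by omega)) ?_
    · rw [DepthGE.congr (Q := fun m => (LabPred l (fun i => i < 2 * (j + 1) ∧ Even i) m ∨
          Finsupp.single (l (2 * (j + 1))) 1 ≤ m) ∨
          Finsupp.single (l (2 * (j + 1) + 1)) 1 ≤ m),
        DepthGE.or_ge_iff (monotone_or (labPred_mono _ _) (monotone_ge _)) (by simp),
        DepthGE.or_ge_iff (labPred_mono _ _) (by simp)] at h3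
      · exact h3.mono (by omega)
      · intro m h
        rw [labPred_add_iff] at h
        refine labPred_anti l (fun i hi => ⟨hi, ?_⟩) h
        obtain ⟨hi, c, rfl⟩ := hi
        rw [single_apply_eq_zero_iff, single_apply_eq_zero_iff, Ne, Ne, key, key] <;> omega
      · rintro m (h | h)
        · left
          rw [labPred_add_iff] at h
          refine labPred_anti l (fun i hi => ⟨hi, ?_⟩) h
          rw [single_apply_eq_zero_iff, single_apply_eq_zero_iff, Ne, Ne, key, key] <;> omega
        · right
          rw [single_le_iff_ne_zero] at h ⊢
          rwa [Finsupp.add_apply, (single_apply_eq_zero_iff _ _).2, add_zero] at h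
          rw [Ne, key] <;> omega
      · intro m
        simp only [single_le_iff_ne_zero, or_assoc]
    · refine ((DepthGE.congr fun m => ?_).1 h).mono (by omega)
      constructor
      · intro h
        exact ⟨labPred_anti l (fun i hi => ⟨by omega, hi.2⟩) h, h _ ⟨by omega, by simp⟩⟩
      · rintro ⟨h4, h5⟩ i ⟨hi, hi2⟩
        by_cases h6 : i < 2 * (j + 1)
        · exact h4 i ⟨h6, hi2⟩
        · obtain rfl : i = 2 * (j + 1) := by
            obtain ⟨c, rfl⟩ := hi2
            omega
          exact h5

/-- The cover ideal of the pentagon has depth less than three. -/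
lemma not_depthGE_pentagon (ρ : Fin 5 → ℕ) (hρ : ∀ u, ρ u = 0) :
    ¬ DepthGE K (CyclePred 1 ρ) 3 := by
  intro h
  have hl := cycLab_injOn (r := 5) 0
  have h0 := not_depthGE_evenEdges (K := K) (Fintype.card_fin 5) _ hl 1 (by omega)
  refine h0 ?_
  have key {i j : ℕ} (hi : i < 5) (hj : j < 5) : cycLab 5 0 i = cycLab 5 0 j ↔ i = j :=
    ⟨hl i j hi hj, fun h => by rw [h]⟩
  have h5 : cycLab 5 0 (4 + 1) = cycLab 5 0 0 := cycLab_add_self 0 0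
  have hA : DepthGE K (LabPred (cycLab 5 0) fun i => i < 3) 2 := by
    refine depthGE_path (Fintype.card_fin 5) _ hl 3 (by omega) 3 0 2 2 _ (by omega)
      (fun i hi => by omega) (fun hc => ?_) (by omega)
    have := hc.two_mul_add_le (b := 3) (fun i hi => hi)
    omega
  have hB : DepthGE K (LabPred (cycLab 5 3) fun i => i < 2) 2 := by
    refine depthGE_path (Fintype.card_fin 5) _ (cycLab_injOn 3) 2 (by omega) 2 0 2 2 _ (by omega)
      (fun i hi => by omega) (fun hc => ?_) (by omega)
    have := hc.two_mul_add_le (b := 2) (fun i hi => hi)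
    omega
  have hB' (m : Fin 5 →₀ ℕ) : LabPred (cycLab 5 3) (fun i => i < 2) m ↔
      (m (cycLab 5 0 3) ≠ 0 ∨ m (cycLab 5 0 4) ≠ 0) ∧
      (m (cycLab 5 0 4) ≠ 0 ∨ m (cycLab 5 0 0) ≠ 0) := by
    refine ⟨fun h => ⟨h 0 (by simp), h 1 (by simp)⟩, fun h i hi => ?_⟩
    obtain rfl | rfl : i = 0 ∨ i = 1 := by omega
    · exact h.1
    · exact h.2
  have hA' (m : Fin 5 →₀ ℕ) : LabPred (cycLab 5 0) (fun i => i < 3) m ↔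
      (m (cycLab 5 0 0) ≠ 0 ∨ m (cycLab 5 0 1) ≠ 0) ∧
      (m (cycLab 5 0 1) ≠ 0 ∨ m (cycLab 5 0 2) ≠ 0) ∧
      (m (cycLab 5 0 2) ≠ 0 ∨ m (cycLab 5 0 3) ≠ 0) := by
    refine ⟨fun h => ⟨h 0 (by simp), h 1 (by simp), h 2 (by simp)⟩, fun h i hi => ?_⟩
    obtain rfl | rfl | rfl : i = 0 ∨ i = 1 ∨ i = 2 := by omega
    · exact h.1
    · exact h.2.1
    · exact h.2.2
  have hJ (m : Fin 5 →₀ ℕ) :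
      LabPred (cycLab 5 0) (fun i => i < 2 * (1 + 1) ∧ Even i) m ↔
      (m (cycLab 5 0 0) ≠ 0 ∨ m (cycLab 5 0 1) ≠ 0) ∧
      (m (cycLab 5 0 2) ≠ 0 ∨ m (cycLab 5 0 3) ≠ 0) := by
    refine ⟨fun h => ⟨h 0 (by simp), h 2 (by simp)⟩, fun h i hi => ?_⟩
    obtain rfl | rfl : i = 0 ∨ i = 2 := by
      obtain ⟨hi, c, rfl⟩ := hi
      omega
    · exact h.1
    · exact h.2
  have hmv := DepthGE.or_of_and (labPred_mono _ _) (labPred_mono _ _) hA hB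
    ((DepthGE.congr fun m => ?_).1 h)
  · rw [DepthGE.congr (Q := fun m => LabPred (cycLab 5 0) (fun i => i < 2 * (1 + 1) ∧ Even i) m ∨
      Finsupp.single (cycLab 5 0 4) 1 ≤ m), DepthGE.or_ge_iff (labPred_mono _ _) (by simp)] at hmv
    · exact hmv.mono (by omega)
    · intro m h
      rw [labPred_add_iff] at h
      refine labPred_anti _ (fun i hi => ⟨hi, ?_⟩) h
      obtain ⟨hi, c, rfl⟩ := hi
      rw [single_apply_eq_zero_iff, single_apply_eq_zero_iff, Ne, Ne, key, key] <;> omega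
    · intro m
      rw [hA', hB', hJ, single_le_iff_ne_zero]
      tauto
  · rw [cyclePred_iff (by omega) 1 ρ 0]
    simp only [hρ]
    constructor
    · intro h
      refine ⟨fun i hi => h i ⟨by omega, by omega⟩, (hB' m).2 ⟨h 3 (by simp), ?_⟩⟩
      have := h 4 (by simp)
      rwa [h5] at this
    · rintro ⟨h6, h7⟩ i ⟨hi, -⟩
      rw [hB'] at h7
      obtain h8 | rfl | rfl : i < 3 ∨ i = 3 ∨ i = 4 := by omega
      · exact h6 i h8
      · exact h7.1
      · rw [h5]
        exact h7.2

end Sharp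

section Expand

variable {V : Type} [Finite V] {K : Type u} [Field K] {P : (V →₀ ℕ) → Prop} {N : ℕ}

/-- The exponent vector `N • m + ρ`. -/
noncomputable def expandExp (ρ : V → Fin N) (m : V →₀ ℕ) : V →₀ ℕ :=
  N • m + Finsupp.equivFunOnFinite.symm fun v => (ρ v : ℕ)

lemma expandExp_apply (ρ : V → Fin N) (m : V →₀ ℕ) (v : V) :
    expandExp ρ m v = N * m v + ρ v := by
  simp [expandExp]

lemma monotone_expandExp (hP : Monotone P) (ρ : V → Fin N) :
    Monotone fun m => P (expandExp ρ m) :=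
  fun _ _ h => hP fun v => by
    rw [expandExp_apply, expandExp_apply]
    gcongr
    exact h v

lemma coeff_expand_mul_monomial [DecidableEq (V → Fin N)] (hN : N ≠ 0) (ρ ρ' : V → Fin N)
    (q : MvPolynomial V K)
    (m : V →₀ ℕ) :
    (expand N q * monomial (expandExp ρ 0) 1).coeff (expandExp ρ' m) =
      if ρ = ρ' then q.coeff m else 0 := by
  split_ifs with h
  · subst h
    have : expandExp ρ m = N • m + expandExp ρ 0 := by simp [expandExp]
    rw [this, coeff_mul_monomial, coeff_expand_smul N hN, mul_one]
  · rw [coeff_mul_monomial']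
    split_ifs with hle
    · rw [mul_one]
      obtain ⟨v, hv⟩ := Function.ne_iff.1 h
      refine coeff_expand_of_not_dvd _ (i := v) ?_
      have h1 := hle v
      rw [expandExp_apply, expandExp_apply] at h1
      rw [Finsupp.tsub_apply, expandExp_apply, expandExp_apply]
      rintro ⟨c, hc⟩
      have h2 : N * m v + ρ' v = N * c + ρ v := by
        simp only [Finsupp.coe_zero, Pi.zero_apply] at h1 hc
        omega
      have h3 := congrArg (· % N) h2
      simp only [Nat.mul_add_mod, Nat.mod_eq_of_lt (Fin.is_lt _)] at h3
      exact hv (Fin.ext h3.symm)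
    · rfl

lemma exists_expandExp_eq (hN : N ≠ 0) (m : V →₀ ℕ) : ∃ (ρ : V → Fin N) (m' : V →₀ ℕ),
    expandExp ρ m' = m := by
  refine ⟨fun v => ⟨m v % N, Nat.mod_lt _ (Nat.pos_of_ne_zero hN)⟩,
    Finsupp.equivFunOnFinite.symm fun v => m v / N, ?_⟩
  ext v
  rw [expandExp_apply]
  exact Nat.div_add_mod _ _

/-- The `expand`-semilinear map `q ↦ expand N q * x ^ ρ` on quotients. -/
noncomputable def expandQuot (hN : N ≠ 0) (hP : Monotone P) (ρ : V → Fin N) :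
    (MvPolynomial V K ⧸ monIdeal K fun m => P (expandExp ρ m))
      →ₛₗ[(expand N : MvPolynomial V K →ₐ[K] MvPolynomial V K).toRingHom]
      (MvPolynomial V K ⧸ monIdeal K P) :=
  Submodule.mapQ _ _
    { toFun := fun q => expand N q * monomial (expandExp ρ 0) 1
      map_add' := fun p q => by rw [map_add, add_mul]
      map_smul' := fun p q => by
        rw [smul_eq_mul, map_mul, mul_assoc]
        rfl }
    (by
      classical
      intro q hq
      rw [Submodule.mem_comap]
      change expand N q * monomial (expandExp ρ 0) 1 ∈ _
      rw [mem_monIdeal (monotone_expandExp hP ρ)] at hq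
      rw [mem_monIdeal hP]
      intro m hm
      obtain ⟨ρ', m', rfl⟩ := exists_expandExp_eq hN m
      rw [coeff_expand_mul_monomial hN] at hm
      split_ifs at hm with h
      · subst h
        exact hq m' hm
      · exact absurd rfl hm)

lemma exists_addEquiv_expand (hN : N ≠ 0) (hP : Monotone P) :
    ∃ e : (∀ ρ : V → Fin N, MvPolynomial V K ⧸ monIdeal K fun m => P (expandExp ρ m)) ≃+
      (MvPolynomial V K ⧸ monIdeal K P),
      ∀ (a : MvPolynomial V K) x, e (a • x) = expand N a • e x := by
  classical
  have := Fintype.ofFinite V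
  let G : (∀ ρ : V → Fin N, MvPolynomial V K ⧸ monIdeal K fun m => P (expandExp ρ m)) →+
      (MvPolynomial V K ⧸ monIdeal K P) :=
    { toFun := fun x => ∑ ρ, expandQuot hN hP ρ (x ρ)
      map_zero' := Finset.sum_eq_zero fun ρ _ => map_zero (expandQuot hN hP ρ)
      map_add' := fun x y => (Finset.sum_congr rfl fun ρ _ =>
        map_add (expandQuot hN hP ρ) _ _).trans Finset.sum_add_distrib }
  have hG (q : (V → Fin N) → MvPolynomial V K) :
      G (fun ρ => Submodule.Quotient.mk (q ρ)) =
        Submodule.Quotient.mk (∑ ρ, expand N (q ρ) * monomial (expandExp ρ 0) 1) := by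
    rw [← Submodule.mkQ_apply, map_sum]
    rfl
  refine ⟨AddEquiv.ofBijective G ⟨?_, ?_⟩, fun a x => ?_⟩
  · rw [injective_iff_map_eq_zero]
    intro x hx
    choose q hq using fun ρ => Submodule.Quotient.mk_surjective _ (x ρ)
    obtain rfl : (fun ρ => Submodule.Quotient.mk (q ρ)) = x := funext hq
    rw [hG, Submodule.Quotient.mk_eq_zero, mem_monIdeal hP] at hx
    funext ρ
    refine (Submodule.Quotient.mk_eq_zero _).2 ?_
    rw [mem_monIdeal (monotone_expandExp hP ρ)]
    intro m hm
    refine hx _ ?_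
    rw [coeff_sum]
    simpa [coeff_expand_mul_monomial hN] using hm
  · intro y
    obtain ⟨p, rfl⟩ := Submodule.Quotient.mk_surjective _ y
    induction p using induction_on' with
    | monomial m c =>
      obtain ⟨ρ, m', rfl⟩ := exists_expandExp_eq hN m
      refine ⟨_, (hG (Pi.single ρ (monomial m' c))).trans ?_⟩
      rw [Finset.sum_eq_single ρ (fun ρ' _ h => by rw [Pi.single_eq_of_ne h, map_zero, zero_mul])
        (by simp), Pi.single_eq_same, expand_monomial, monomial_mul, mul_one]
      simp [expandExp]
    | add p q hp hq =>
      obtain ⟨x, hx⟩ := hp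
      obtain ⟨y, hy⟩ := hq
      exact ⟨x + y, by rw [map_add, hx, hy, Submodule.Quotient.mk_add]⟩
  · change ∑ ρ, expandQuot hN hP ρ (a • x ρ) = expand N a • ∑ ρ, expandQuot hN hP ρ (x ρ)
    rw [Finset.smul_sum]
    exact Finset.sum_congr rfl fun ρ _ => LinearMap.map_smulₛₗ _ _ _

lemma smul_quotient_eq_zero {R : Type*} [CommRing R] {m : Ideal R} {a : R} (ha : a ∈ m)
    (x : R ⧸ m) : a • x = 0 := by
  obtain ⟨p, rfl⟩ := Submodule.Quotient.mk_surjective _ x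
  rw [← Submodule.Quotient.mk_smul, Submodule.Quotient.mk_eq_zero]
  exact Ideal.mul_mem_right _ _ ha

/-- The depth of a monomial ideal is the minimum of the depths of the monomial ideals obtained by
prescribing the residues modulo `N` of the exponents. -/
lemma depthGE_iff_forall_expandExp (hN : N ≠ 0) (hP : Monotone P) (d : ℕ) :
    DepthGE K P d ↔ ∀ ρ : V → Fin N, DepthGE K (fun m => P (expandExp ρ m)) d := by
  classical
  obtain ⟨e, he⟩ := exists_addEquiv_expand (K := K) hN hP
  have hwr (rs : List (MvPolynomial V K)) :
      RingTheory.Sequence.IsWeaklyRegular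
        (∀ ρ : V → Fin N, MvPolynomial V K ⧸ monIdeal K fun m => P (expandExp ρ m)) rs ↔
      RingTheory.Sequence.IsWeaklyRegular (MvPolynomial V K ⧸ monIdeal K P)
        (rs.map (expand N : MvPolynomial V K →ₐ[K] MvPolynomial V K).toRingHom) :=
    AddEquiv.isWeaklyRegular_congr (e := e) <| List.forall₂_map_right_iff.2 <|
      List.forall₂_same.2 fun r _ x => he r x
  constructor
  · intro h ρ
    have hφ (p : Ideal (MvPolynomial V K)) (hp : p.IsPrime)
        (hle : Ideal.span (Set.range (X : V → MvPolynomial V K)) ≤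
          p.comap (expand N : MvPolynomial V K →ₐ[K] MvPolynomial V K).toRingHom) :
        Ideal.span (Set.range (X : V → MvPolynomial V K)) ≤ p := by
      rw [Ideal.span_le] at hle ⊢
      rintro _ ⟨v, rfl⟩
      have := hle ⟨v, rfl⟩
      simp only [AlgHom.toRingHom_eq_coe, SetLike.mem_coe, Ideal.mem_comap, RingHom.coe_coe,
        expand_X] at this
      exact hp.mem_of_pow_mem _ this
    obtain ⟨rs, rfl, hm, hrs⟩ := ExtVanish.exists_isWeaklyRegular _ hφ d _ h
    rw [← hwr] at hrs
    exact ExtVanish.of_retract (LinearMap.single (MvPolynomial V K) (fun ρ : V → Fin N =>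
      MvPolynomial V K ⧸ monIdeal K fun m => P (expandExp ρ m)) ρ) (LinearMap.proj ρ)
      (LinearMap.proj_comp_single_same ..) (ExtVanish.of_isWeaklyRegular rs
        (fun r hr n => smul_quotient_eq_zero (hm r hr) n) _ hrs)
  · intro h
    obtain ⟨rs, rfl, hm, hrs⟩ := ExtVanish.exists_isWeaklyRegular
      (I := Ideal.span (Set.range (X : V → MvPolynomial V K))) (RingHom.id _)
      (fun p _ hp => hp) d _ (ExtVanish.pi h)
    rw [RingHom.coe_id, List.map_id, hwr] at hrs
    have := ExtVanish.of_isWeaklyRegular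
      (N := MvPolynomial V K ⧸ Ideal.span (Set.range (X : V → MvPolynomial V K))) _ ?_ _ hrs
    · rwa [List.length_map] at this
    · intro r hr n
      obtain ⟨s, hs, rfl⟩ := List.mem_map.1 hr
      refine smul_quotient_eq_zero ?_ n
      have hle : Ideal.span (Set.range (X : V → MvPolynomial V K)) ≤ Ideal.comap
          (expand N : MvPolynomial V K →ₐ[K] MvPolynomial V K).toRingHom
          (Ideal.span (Set.range X)) := by
        rw [Ideal.span_le]
        rintro _ ⟨v, rfl⟩
        simp only [AlgHom.toRingHom_eq_coe, SetLike.mem_coe, Ideal.mem_comap, RingHom.coe_coe,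
          expand_X]
        exact Ideal.pow_mem_of_mem _ (Ideal.subset_span (Set.mem_range_self v)) _
          (Nat.pos_of_ne_zero hN)
      exact hle (hm s hs)

end Expand

section Depth

variable {V : Type} {K : Type u} [Field K] {P : (V →₀ ℕ) → Prop}

lemma depthQ_monIdeal [Finite V] (hP : Monotone P) (h0 : ¬ P 0) :
    depthQ K (monIdeal K P) = sSup {d | DepthGE K P d} := by
  unfold depthQ
  congr 1
  ext d
  constructor
  · rintro ⟨rs, rfl, hm, hrs⟩
    exact ExtVanish.of_isWeaklyRegular rs (fun r hr n => smul_quotient_eq_zero (hm r hr) n) _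
      hrs.toIsWeaklyRegular
  · intro h
    obtain ⟨rs, hl, hm, hrs⟩ := ExtVanish.exists_isWeaklyRegular (RingHom.id _)
      (fun p _ hp => hp) d _ h
    rw [RingHom.coe_id, List.map_id] at hrs
    refine ⟨rs, hl, hm, hrs, fun htop => ?_⟩
    have hle : monIdeal K P ≤ Ideal.span (Set.range X) := by
      intro p hp
      rw [mem_monIdeal hP] at hp
      rw [← Set.image_univ, mem_ideal_span_X_image]
      intro m hm
      by_contra! h
      obtain rfl : m = 0 := Finsupp.ext fun v => h v trivial
      exact h0 (hp 0 (mem_support_iff.1 hm))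
    have hker : Ideal.ofList rs • (⊤ : Submodule (MvPolynomial V K) (_ ⧸ monIdeal K P)) ≤
        LinearMap.ker (Submodule.factor hle) := by
      rw [Submodule.smul_le]
      intro a ha x _
      rw [LinearMap.mem_ker, map_smul]
      exact smul_quotient_eq_zero (Ideal.span_le.2 (fun f hf => hm f hf) ha) _
    rw [← htop] at hker
    have h1 := hker (Submodule.mem_top (x := Submodule.Quotient.mk (1 : MvPolynomial V K)))
    have h2 : (1 : MvPolynomial V K) ∈ Ideal.span (Set.range (X : V → MvPolynomial V K)) :=
      (Submodule.Quotient.mk_eq_zero _).1 h1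
    rw [← Set.image_univ, mem_ideal_span_X_image] at h2
    simpa using h2 0 (by simp)

/-- The exponent vectors of the monomials in the `n`-th symbolic power of the cover ideal. -/
def SymbPred (G : SimpleGraph V) (n : ℕ) (m : V →₀ ℕ) : Prop :=
  ∀ u v, G.Adj u v → n ≤ m u + m v

lemma symbPred_mono (G : SimpleGraph V) (n : ℕ) : Monotone (SymbPred G n) :=
  fun _ _ hab h u v huv => (h u v huv).trans (add_le_add (hab u) (hab v))

lemma monotone_le_add (u v : V) (n : ℕ) : Monotone fun m : V →₀ ℕ => n ≤ m u + m v :=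
  fun _ _ hab h => h.trans (add_le_add (hab u) (hab v))

lemma span_pair_pow {u v : V} (huv : u ≠ v) (n : ℕ) :
    (Ideal.span {X u, X v} : Ideal (MvPolynomial V K)) ^ n =
      monIdeal K fun m => n ≤ m u + m v := by
  classical
  refine le_antisymm ?_ fun p hp => ?_
  · induction n with
    | zero => exact fun _ _ _ _ _ _ => Nat.zero_le _
    | succ n ih =>
      rw [pow_succ, Ideal.mul_le]
      intro p hp q hq
      have hp := ih hp
      have hle : Ideal.span {X u, X v} ≤ monIdeal K fun m : V →₀ ℕ => 1 ≤ m u + m v := by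
        rw [Ideal.span_le, Set.pair_subset_iff]
        exact ⟨monomial_mem_monIdeal (monotone_le_add u v 1) (by simp) 1,
          monomial_mem_monIdeal (monotone_le_add u v 1) (by simp) 1⟩
      have hq := hle hq
      rw [mem_monIdeal (monotone_le_add u v _)] at hp hq ⊢
      intro m hm
      rw [coeff_mul] at hm
      obtain ⟨x, hx, hx0⟩ := Finset.exists_ne_zero_of_sum_ne_zero hm
      have h1 := hp _ (left_ne_zero_of_mul hx0)
      have h2 := hq _ (right_ne_zero_of_mul hx0)
      rw [← Finset.HasAntidiagonal.mem_antidiagonal.1 hx, Finsupp.add_apply, Finsupp.add_apply]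
      omega
  · rw [mem_monIdeal (monotone_le_add u v _)] at hp
    rw [p.as_sum]
    refine Submodule.sum_mem _ fun m hm => ?_
    refine Ideal.pow_le_pow_right (hp m (mem_support_iff.1 hm)) ?_
    have hle : Finsupp.single u (m u) + Finsupp.single v (m v) ≤ m := by
      intro w
      simp only [Finsupp.add_apply, Finsupp.single_apply]
      split_ifs with h1 h2 h2
      · exact absurd (h1.trans h2.symm) huv
      · rw [h1, add_zero]
      · rw [h2, zero_add]
      · exact Nat.zero_le _
    have : monomial m (p.coeff m) = X u ^ m u * X v ^ m v *
        monomial (m - (Finsupp.single u (m u) + Finsupp.single v (m v))) (p.coeff m) := by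
      rw [X_pow_eq_monomial, X_pow_eq_monomial, monomial_mul, monomial_mul,
        add_tsub_cancel_of_le hle, one_mul, one_mul]
    rw [this, pow_add]
    exact Ideal.mul_mem_right _ _ (Ideal.mul_mem_mul
      (Ideal.pow_mem_pow (Ideal.subset_span (by simp)) _)
      (Ideal.pow_mem_pow (Ideal.subset_span (by simp)) _))

lemma symbPow_eq_monIdeal (G : SimpleGraph V) (n : ℕ) :
    symbPow K G n = monIdeal K (SymbPred G n) := by
  ext p
  simp only [symbPow, Submodule.mem_iInf, Prod.forall]
  rw [mem_monIdeal (symbPred_mono G n)]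
  constructor
  · intro h m hm u v huv
    have := h u v huv
    rw [span_pair_pow huv.ne, mem_monIdeal (monotone_le_add u v n)] at this
    exact this m hm
  · intro h u v huv
    rw [span_pair_pow huv.ne, mem_monIdeal (monotone_le_add u v n)]
    exact fun m hm => h m hm u v huv

end Depth

section CycleDepth

variable {K : Type u} [Field K] {r k n : ℕ}

lemma depthQ_symbPow_cycleGraph [NeZero r] (hr : 2 ≤ r) (hn : 1 ≤ n) :
    depthQ K (symbPow K (SimpleGraph.cycleGraph r) n) =
      sSup {d | ∀ ρ : Fin r → Fin (n + 1), DepthGE K (CyclePred n fun u => ρ u) d} := by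
  rw [symbPow_eq_monIdeal, depthQ_monIdeal (symbPred_mono _ _)]
  · congr 1
    ext d
    rw [Set.mem_ofPred_eq,
      depthGE_iff_forall_expandExp (Nat.add_one_ne_zero n) (symbPred_mono _ _)]
    refine forall_congr' fun ρ => DepthGE.congr fun m => ?_
    refine forall_congr' fun u => forall_congr' fun v => forall_congr' fun _ => ?_
    rw [expandExp_apply, expandExp_apply]
    change (n ≤ (n + 1) * m u + ρ u + ((n + 1) * m v + ρ v)) ↔
      ((ρ u : ℕ) + ρ v < n → m u ≠ 0 ∨ m v ≠ 0)
    constructor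
    · intro h h1
      by_contra! h2
      rw [h2.1, h2.2] at h
      omega
    · intro h
      by_cases h1 : (ρ u : ℕ) + ρ v < n
      · obtain h | h := h h1
        · have := Nat.le_mul_of_pos_right (n + 1) (Nat.pos_of_ne_zero h)
          omega
        · have := Nat.le_mul_of_pos_right (n + 1) (Nat.pos_of_ne_zero h)
          omega
      · omega
  · intro h
    have := h _ _ ((cycleGraph_adj_iff_cycLab hr 0 _ _).2 ⟨0, by omega, .inl ⟨rfl, rfl⟩⟩)
    simp at this
    omega

lemma exists_not_depthGE [NeZero r] (hk : 1 ≤ k) (hr : r = 2 * k + 1) (hn : k ≤ n) :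
    ∃ ρ : Fin r → Fin (n + 1), ¬ DepthGE K (CyclePred n fun u => ρ u) (k + 1) := by
  let α : ℕ → ℕ := fun i => if i = 2 * k then n else if Even i then i / 2 else n - 1 - i / 2
  have hα (u : Fin r) : α u < n + 1 := by
    have := u.2
    simp only [α]
    split_ifs <;> omega
  refine ⟨fun u => ⟨α u, hα u⟩, fun h => ?_⟩
  obtain ⟨j, rfl⟩ : ∃ j, k = j + 1 := ⟨k - 1, by omega⟩
  refine not_depthGE_evenEdges (K := K) (Fintype.card_fin r) (cycLab r 0) (cycLab_injOn 0) j
    (by omega) ?_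
  rw [show r - (j + 1) = j + 1 + 1 by omega]
  refine (DepthGE.congr fun m => ?_).1 h
  rw [cyclePred_iff (by omega) n _ 0]
  refine labPred_congr _ (fun i => ?_) m
  have hval {i : ℕ} (hi : i < r) : (cycLab r 0 i : ℕ) = i := Nat.mod_eq_of_lt hi
  have hval0 : (cycLab r 0 r : ℕ) = 0 := by simp [cycLab]
  simp only
  by_cases hir : i < r
  · rw [hval hir, and_iff_right hir]
    by_cases hi : i + 1 = r
    · rw [hi, hval0]
      simp [α, show i = 2 * (j + 1) by omega]
    · rw [hval (by omega)]
      obtain ⟨c, rfl | rfl⟩ := i.even_or_odd'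
      · have h1 : α (2 * c) = c := by
          simp only [α]
          rw [if_neg (by omega), if_pos (by simp)]
          omega
        have h2 : α (2 * c + 1) = n - 1 - c := by
          simp only [α]
          rw [if_neg (by omega), if_neg (by simp)]
          omega
        rw [h1, h2]
        simp only [even_two, Even.mul_right, and_true]
        omega
      · have h1 : α (2 * c + 1) = n - 1 - c := by
          simp only [α]
          rw [if_neg (by omega), if_neg (by simp)]
          omega
        have h2 : c + 1 ≤ α (2 * c + 1 + 1) := by
          simp only [α]
          split_ifs with h3 h4
          · omega
          · omega
          · exact absurd (by use c + 1; omega) h4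
        rw [h1]
        simp only [Nat.not_even_bit1, and_false, iff_false]
        omega
  · simp only [hir, false_and, false_iff]
    omega

lemma depthQ_eq_of_not_depthGE [NeZero r] (hk : 1 ≤ k) (hr : r = 2 * k + 1) (hn : 1 ≤ n)
    (h : ∃ ρ : Fin r → Fin (n + 1), ¬ DepthGE K (CyclePred n fun u => ρ u) (k + 1)) :
    depthQ K (symbPow K (SimpleGraph.cycleGraph r) n) = k := by
  rw [depthQ_symbPow_cycleGraph (by omega) hn]
  refine IsGreatest.csSup_eq ⟨fun ρ => depthGE_cyclePred hk hr n _, fun d hd => ?_⟩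
  obtain ⟨ρ, hρ⟩ := h
  by_contra hlt
  exact hρ ((hd ρ).mono (by omega))

lemma depthQ_ne [NeZero r] (hk : 3 ≤ k) (hr : r = 2 * k + 1) :
    depthQ K (symbPow K (SimpleGraph.cycleGraph r) (k - 1)) ≠ k := by
  rw [depthQ_symbPow_cycleGraph (by omega) (by omega)]
  intro h
  have hmem : k + 1 ∈ {d | ∀ ρ : Fin r → Fin (k - 1 + 1),
      DepthGE K (CyclePred (k - 1) fun u => ρ u) d} :=
    fun ρ => depthGE_cyclePred_succ hk hr _
  by_cases hb : BddAbove {d | ∀ ρ : Fin r → Fin (k - 1 + 1),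
      DepthGE K (CyclePred (k - 1) fun u => ρ u) d}
  · have := le_csSup hb hmem
    omega
  · rw [Nat.sSup_of_not_bddAbove hb] at h
    omega

lemma nu0_cycleGraph [NeZero r] (hk : 1 ≤ k) (hr : r = 2 * k + 1) :
    nu0 (SimpleGraph.cycleGraph r) = k := by
  have hadj (u v : Fin r) : (SimpleGraph.cycleGraph r).Adj u v ↔
      ∃ i < r, u = cycLab r 0 i ∧ v = cycLab r 0 (i + 1) ∨
        v = cycLab r 0 i ∧ u = cycLab r 0 (i + 1) := cycleGraph_adj_iff_cycLab (by omega) 0 u v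
  have key {i j : ℕ} (hi : i < r) (hj : j < r) : cycLab r 0 i = cycLab r 0 j ↔ i = j :=
    ⟨cycLab_injOn 0 i j hi hj, fun h => by rw [h]⟩
  have key1 {i j : ℕ} (hi : i < r) (hj : j < r) : cycLab r 0 i = cycLab r 0 (j + 1) ↔
      i = j + 1 ∨ i = 0 ∧ j + 1 = r := by
    by_cases h : j + 1 = r
    · have hwrap : cycLab r 0 (j + 1) = cycLab r 0 0 := by
        rw [← cycLab_add_self 0 0]
        congr 1
        omega
      rw [hwrap, key] <;> omega
    · rw [key] <;> omega
  refine IsGreatest.csSup_eq ⟨⟨fun i => cycLab r 0 (2 * (k - 1 - i)),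
    fun i => cycLab r 0 (2 * (k - 1 - i) + 1), ⟨?_, fun i => ?_⟩, fun i j => ?_, fun i j => ?_⟩, ?_⟩
  · rintro (i | i) (j | j) h <;> simp only [Sum.elim_inl, Sum.elim_inr] at h <;>
      rw [key (by omega) (by omega)] at h
    · exact congrArg Sum.inl (Fin.ext (by omega))
    · omega
    · omega
    · exact congrArg Sum.inr (Fin.ext (by omega))
  · rw [hadj]
    exact ⟨_, by omega, .inl ⟨rfl, rfl⟩⟩
  · rw [hadj]
    rintro ⟨c, hc, ⟨h1, h2⟩ | ⟨h1, h2⟩⟩ <;> rw [key (by omega) hc] at h1 <;>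
      rw [key1 (by omega) hc] at h2 <;> omega
  · rw [hadj]
    rintro ⟨c, hc, ⟨h1, h2⟩ | ⟨h1, h2⟩⟩ <;> rw [key (by omega) hc] at h1 <;>
      rw [key1 (by omega) hc] at h2 <;> rw [Fin.le_def] <;> omega
  · rintro s ⟨u, v, ⟨hinj, -⟩, -⟩
    have := Fintype.card_le_of_injective _ hinj
    simp only [Fintype.card_sum, Fintype.card_fin] at this
    omega

end CycleDepth

end DS

/-- For the odd cycle `C_r` (`r ≥ 3` odd): `sdst(J(C_r)) = 1` if `r = 5`, and
`sdst(J(C_r)) = (r − 1)/2` otherwise. -/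
theorem stmt_18 (K : Type*) [Field K] (r : ℕ) (hr : 3 ≤ r) (hodd : Odd r) :
    DS.sdst K (SimpleGraph.cycleGraph r) = if r = 5 then 1 else (r - 1) / 2 := by
  obtain ⟨k, hk⟩ := hodd
  have hk1 : 1 ≤ k := by omega
  have : NeZero r := ⟨by omega⟩
  have hstable (n : ℕ) (hn : k ≤ n) : DS.depthQ K (DS.symbPow K (SimpleGraph.cycleGraph r) n) = k :=
    DS.depthQ_eq_of_not_depthGE hk1 hk (by omega) (DS.exists_not_depthGE hk1 hk hn)
  have hlim : Fintype.card (Fin r) - DS.nu0 (SimpleGraph.cycleGraph r) - 1 = k := by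
    rw [Fintype.card_fin, DS.nu0_cycleGraph hk1 hk]
    omega
  unfold DS.sdst
  rw [hlim]
  split_ifs with h5
  · refine IsLeast.csInf_eq ⟨⟨le_rfl, fun n hn => ?_⟩, fun n hn => hn.1⟩
    obtain h | rfl : k ≤ n ∨ n = 1 := by omega
    · exact hstable n h
    · subst h5
      obtain rfl : k = 2 := by omega
      exact DS.depthQ_eq_of_not_depthGE hk1 hk le_rfl
        ⟨fun _ => 0, DS.not_depthGE_pentagon _ fun _ => rfl⟩
  · rw [show (r - 1) / 2 = k by omega]
    refine IsLeast.csInf_eq ⟨⟨hk1, hstable⟩, fun n hn => ?_⟩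
    by_contra hlt
    have h1 := hn.1
    exact DS.depthQ_ne (by omega) hk (hn.2 (k - 1) (by omega))
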